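/- Assume the blow-up setup with n/(n−2) < p ≤ (n+2)/(n−2), and assume in addition: d_k → 0; there is C₀ > 0 such that v_k(y) ≤ C₀ λ_k^{n/(p+1)} (1+λ_k|y−x_k|)^{2−n} for all y ∈ Ω and all k; and there is a continuous function V : ℝⁿ → (0,∞) with V(x) ≤ C₀(1+|x|)^{2−n} such that for every x ∈ ℝⁿ one has λ_k^{−n/(p+1)} v_k(λ_k^{−1}x + x_k) → V(x) as k → ∞. Set A_V := ∫_{ℝⁿ} V(y)^p dy (finite since (n−2)p > n). Then each u_k is differentiable on Ω and there is a sequence η_k ≥ 0 with η_k → 0 such that for all k and all x with |x−x_k| = 2d_k: |u_k(x) − A_V λ_k^{−n/(p+1)} G(x,x_k)| ≤ η_k λ_k^{−n/(p+1)} d_k^{−(n−2)} and |∇_x u_k(x) − A_V λ_k^{−n/(p+1)} ∇_x G(x,x_k)| ≤ η_k λ_k^{−n/(p+1)} d_k^{−(n−1)}. -/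

import Mathlib

open MeasureTheory Metric Filter Topology RealInnerProductSpace

noncomputable section

abbrev Euc (n : ℕ) := EuclideanSpace ℝ (Fin n)

noncomputable def surf (n : ℕ) : Measure (Euc n) := μH[(n : ℝ) - 1]

noncomputable def omegaSph (n : ℕ) : ℝ := (surf n (sphere (0 : Euc n) 1)).toReal

/-- `c_n = 1/((n-2) ω_{n-1})`. -/
noncomputable def cGreen (n : ℕ) : ℝ := 1 / (((n : ℝ) - 2) * omegaSph n)

/-- Laplacian on `ℝⁿ`. -/
noncomputable def lap (n : ℕ) (u : Euc n → ℝ) (x : Euc n) : ℝ :=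
  ∑ i : Fin n, fderiv ℝ (fun y => fderiv ℝ u y (EuclideanSpace.single i 1)) x
    (EuclideanSpace.single i 1)

/-- The blow-up setup: a bounded open set `Ω ⊆ ℝⁿ` with a Green-type kernel `G`
(with regular part `H`), exponents `p, q` on the critical hyperbola, perturbed exponents
`q_k` with `ε_k → 0`, positive solutions `(u_k, v_k)` of the integral form of the Lane–Emden
system, maximum values `λ_k` attained at `x_k`, with `λ_k → ∞`, `N_k = λ_k d_k → ∞` and
`λ_k^{ε_k}` bounded. -/
structure BlowupSetup (n : ℕ) where
  Ω : Set (Euc n)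
  hΩo : IsOpen Ω
  hΩb : Bornology.IsBounded Ω
  G : Euc n → Euc n → ℝ
  H : Euc n → Euc n → ℝ
  Gsymm : ∀ x y, G x y = G y x
  Gdecomp : ∀ x ∈ Ω, ∀ y ∈ Ω, x ≠ y →
    G x y = cGreen n * ‖x - y‖ ^ ((2 : ℝ) - n) - H x y
  Hharm : ∀ y ∈ Ω, ContDiffOn ℝ 2 (fun x => H x y) Ω ∧
    ∀ x ∈ Ω, lap n (fun z => H z y) x = 0
  Gpos : ∀ x ∈ Ω, ∀ y ∈ Ω, x ≠ y → 0 < G x y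
  Gle : ∀ x ∈ Ω, ∀ y ∈ Ω, x ≠ y → G x y ≤ cGreen n * ‖x - y‖ ^ ((2 : ℝ) - n)
  p : ℝ
  hp : 1 ≤ p
  q : ℝ
  hq : 0 < q
  hpq : 1 / (p + 1) + 1 / (q + 1) = ((n : ℝ) - 2) / n
  eps : ℕ → ℝ
  heps : ∀ k, 0 < eps k
  heps0 : Filter.Tendsto eps Filter.atTop (nhds 0)
  qk : ℕ → ℝ
  hqk : ∀ k, 0 < qk k
  hqk_eq : ∀ k, 1 / (p + 1) + 1 / (qk k + 1) = ((n : ℝ) - 2) / n + eps k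
  u : ℕ → Euc n → ℝ
  v : ℕ → Euc n → ℝ
  hu_cont : ∀ k, ContinuousOn (u k) Ω
  hv_cont : ∀ k, ContinuousOn (v k) Ω
  hu_pos : ∀ k, ∀ x ∈ Ω, 0 < u k x
  hv_pos : ∀ k, ∀ x ∈ Ω, 0 < v k x
  hu_eq : ∀ k, ∀ x ∈ Ω, u k x = ∫ y in Ω, G x y * (v k y) ^ p
  hv_eq : ∀ k, ∀ x ∈ Ω, v k x = ∫ y in Ω, G x y * (u k y) ^ qk k
  lam : ℕ → ℝ
  xk : ℕ → Euc n
  hxk : ∀ k, xk k ∈ Ω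
  hlam_eq : ∀ k,
    lam k = max ((v k (xk k)) ^ ((p + 1) / n)) ((u k (xk k)) ^ ((qk k + 1) / n))
  hlam_sup : ∀ k, ∀ x ∈ Ω,
    max ((v k x) ^ ((p + 1) / n)) ((u k x) ^ ((qk k + 1) / n)) ≤ lam k
  hlam_top : Filter.Tendsto lam Filter.atTop Filter.atTop
  hN_top : Filter.Tendsto (fun k => lam k * (Metric.infDist (xk k) (frontier Ω) / 4))
    Filter.atTop Filter.atTop
  hlam_eps : ∃ C : ℝ, ∀ k, lam k ^ eps k ≤ C

namespace BlowupSetup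

variable {n : ℕ}

/-- `d_k = dist(x_k, ∂Ω)/4`. -/
noncomputable def d (S : BlowupSetup n) (k : ℕ) : ℝ :=
  Metric.infDist (S.xk k) (frontier S.Ω) / 4

/-- `N_k = λ_k d_k`. -/
noncomputable def N (S : BlowupSetup n) (k : ℕ) : ℝ := S.lam k * S.d k

end BlowupSetup

/-- Differentiation under the integral sign against a continuous compactly supported weight,
along lines `t ↦ a z + t • b z`. -/
lemma hasDerivAt_integral_line_mul {E : Type*} [NormedAddCommGroup E] [NormedSpace ℝ E]
    [MeasurableSpace E] [BorelSpace E] [FiniteDimensional ℝ E] {μ : Measure E}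
    [IsFiniteMeasureOnCompacts μ]
    {h η : E → ℝ} (hh : ContDiff ℝ 1 h) (hη : Continuous η) (hc : HasCompactSupport η)
    {a b : E → E} (ha : Continuous a) (hb : Continuous b) (t₀ : ℝ) :
    HasDerivAt (fun t : ℝ => ∫ z, h (a z + t • b z) * η z ∂μ)
      (∫ z, fderiv ℝ h (a z + t₀ • b z) (b z) * η z ∂μ) t₀ := by
  have hf' : Continuous (fderiv ℝ h) := hh.continuous_fderiv one_ne_zero
  have hcont : Continuous fun q : ℝ × E => fderiv ℝ h (a q.2 + q.1 • b q.2) (b q.2) * η q.2 := by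
    fun_prop
  obtain ⟨C, hC⟩ := ((isCompact_closedBall t₀ 1).prod hc.isCompact).exists_bound_of_continuousOn
    hcont.continuousOn
  have hcs : ∀ g : E → ℝ, HasCompactSupport fun z => g z * η z := fun g => hc.mul_left
  refine (hasDerivAt_integral_of_dominated_loc_of_deriv_le
    (F := fun t z => h (a z + t • b z) * η z)
    (F' := fun t z => fderiv ℝ h (a z + t • b z) (b z) * η z)
    (bound := (tsupport η).indicator fun _ => C)
    (s := closedBall t₀ 1) (closedBall_mem_nhds _ one_pos) ?_ ?_ ?_ ?_ ?_ ?_).2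
  · refine Eventually.of_forall fun t => Continuous.aestronglyMeasurable ?_
    have := hh.continuous
    fun_prop
  · refine Continuous.integrable_of_hasCompactSupport ?_ (hcs _)
    have := hh.continuous
    fun_prop
  · refine Continuous.aestronglyMeasurable ?_
    fun_prop
  · refine Eventually.of_forall fun z t ht => ?_
    by_cases hz : z ∈ tsupport η
    · rw [Set.indicator_of_mem hz]
      exact hC (t, z) ⟨ht, hz⟩
    · rw [Set.indicator_of_notMem hz, image_eq_zero_of_notMem_tsupport hz]
      simp
  · exact (integrable_indicator_iff hc.isCompact.measurableSet).2
      (integrableOn_const hc.isCompact.measure_lt_top.ne)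
  · refine Eventually.of_forall fun z t _ => ?_
    have h1 : HasFDerivAt h (fderiv ℝ h (a z + t • b z)) (a z + t • b z) :=
      (hh.differentiable one_ne_zero _).hasFDerivAt
    have h2 : HasDerivAt (fun t : ℝ => a z + t • b z) (b z) t := by
      simpa using ((hasDerivAt_id t).smul_const (b z)).const_add (a z)
    exact (h1.comp_hasDerivAt t h2).mul_const _

/-- Integration by parts against a compactly supported `C¹` weight, after a dilation. -/
lemma integral_fderiv_comp_mul {E : Type*} [NormedAddCommGroup E] [NormedSpace ℝ E]
    [MeasurableSpace E] [BorelSpace E] [FiniteDimensional ℝ E] {μ : Measure E}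
    [μ.IsAddHaarMeasure]
    {h η : E → ℝ} (hh : ContDiff ℝ 1 h) (hη : ContDiff ℝ 1 η) (hc : HasCompactSupport η)
    (x₀ e : E) (r : ℝ) :
    r * ∫ z, fderiv ℝ h (x₀ + r • z) e * η z ∂μ
      = -∫ z, h (x₀ + r • z) * fderiv ℝ η z e ∂μ := by
  have hhr : ContDiff ℝ 1 fun z => h (x₀ + r • z) := by fun_prop
  have hd : ∀ z, fderiv ℝ (fun z => h (x₀ + r • z)) z e = r * fderiv ℝ h (x₀ + r • z) e := by
    intro z
    have h1 : HasFDerivAt h (fderiv ℝ h (x₀ + r • z)) (x₀ + r • z) :=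
      (hh.differentiable one_ne_zero _).hasFDerivAt
    have h2 : HasFDerivAt (fun z : E => x₀ + r • z) (r • ContinuousLinearMap.id ℝ E) z :=
      ((hasFDerivAt_id z).const_smul r).const_add x₀
    have h3 : HasFDerivAt (fun z => h (x₀ + r • z)) _ z := h1.comp z h2
    rw [h3.fderiv]
    simp
  have hf' : Continuous (fderiv ℝ h) := hh.continuous_fderiv one_ne_zero
  have hη' : Continuous (fderiv ℝ η) := hη.continuous_fderiv one_ne_zero
  have hh0 := hh.continuous
  have hη0 := hη.continuous
  have key := integral_mul_fderiv_eq_neg_fderiv_mul_of_integrable (μ := μ)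
    (f := fun z => h (x₀ + r • z)) (g := η) (v := e) ?_ ?_ ?_
    (fun x _ => hhr.differentiable one_ne_zero x) (fun x _ => hη.differentiable one_ne_zero x)
  · rw [key, neg_neg, ← integral_const_mul]
    refine integral_congr_ae (Eventually.of_forall fun z => ?_)
    simp only [hd, mul_assoc]
  · simp only [hd]
    exact Continuous.integrable_of_hasCompactSupport (by fun_prop) hc.mul_left
  · exact Continuous.integrable_of_hasCompactSupport (by fun_prop)
      ((hc.fderiv_apply (𝕜 := ℝ) e).mul_left)
  · exact Continuous.integrable_of_hasCompactSupport (by fun_prop) hc.mul_left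

/-- A smooth nonnegative radial weight supported in the unit ball; it satisfies
`∇Ψ(z) = -radialWeight z • z` for `Ψ z = smoothTransition (2 - 4‖z‖²)`. -/
def radialWeight {E : Type*} [NormedAddCommGroup E] (z : E) : ℝ :=
  8 * deriv Real.smoothTransition (2 - 4 * ‖z‖ ^ 2)

/-- The radial cutoff whose gradient is `-radialWeight z • z`. -/
def radialCutoff {E : Type*} [NormedAddCommGroup E] (z : E) : ℝ :=
  Real.smoothTransition (2 - 4 * ‖z‖ ^ 2)

section RadialWeight

variable {E : Type*} [NormedAddCommGroup E] [InnerProductSpace ℝ E]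

lemma contDiff_radialWeight : ContDiff ℝ 1 (radialWeight : E → ℝ) := by
  have h1 : ContDiff ℝ 1 (deriv Real.smoothTransition) := by
    have : ContDiff ℝ (1 + 1) Real.smoothTransition := Real.smoothTransition.contDiff (n := 2)
    exact (contDiff_succ_iff_deriv.1 this).2.2
  have h2 : ContDiff ℝ 1 fun z : E => 2 - 4 * ‖z‖ ^ 2 :=
    contDiff_const.sub (contDiff_const.mul (contDiff_norm_sq ℝ))
  exact contDiff_const.mul (h1.comp h2)

lemma contDiff_radialCutoff : ContDiff ℝ 1 (radialCutoff : E → ℝ) := by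
  have h2 : ContDiff ℝ 1 fun z : E => 2 - 4 * ‖z‖ ^ 2 :=
    contDiff_const.sub (contDiff_const.mul (contDiff_norm_sq ℝ))
  exact (Real.smoothTransition.contDiff (n := 1)).comp h2

omit [InnerProductSpace ℝ E] in
lemma radialWeight_nonneg (z : E) : 0 ≤ radialWeight z :=
  mul_nonneg (by norm_num) Real.smoothTransition.monotone.deriv_nonneg

omit [InnerProductSpace ℝ E] in
lemma radialCutoff_eq_zero {z : E} (hz : 1 ≤ ‖z‖) : radialCutoff z = 0 :=
  Real.smoothTransition.zero_of_nonpos (by nlinarith)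

omit [InnerProductSpace ℝ E] in
lemma radialWeight_eq_zero {z : E} (hz : 1 ≤ ‖z‖) : radialWeight z = 0 := by
  have hlt : 2 - 4 * ‖z‖ ^ 2 < 0 := by nlinarith
  have : Real.smoothTransition =ᶠ[𝓝 (2 - 4 * ‖z‖ ^ 2)] fun _ => (0 : ℝ) := by
    filter_upwards [Iio_mem_nhds hlt] with t ht
    exact Real.smoothTransition.zero_of_nonpos (le_of_lt ht)
  rw [radialWeight, this.deriv_eq]
  simp

lemma fderiv_radialCutoff (z e : E) : fderiv ℝ radialCutoff z e = -(radialWeight z * ⟪z, e⟫) := by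
  have h1 : HasDerivAt Real.smoothTransition
      (deriv Real.smoothTransition (2 - 4 * ‖z‖ ^ 2)) (2 - 4 * ‖z‖ ^ 2) :=
    ((Real.smoothTransition.contDiff (n := 1)).differentiable one_ne_zero _).hasDerivAt
  have h2 := ((hasStrictFDerivAt_norm_sq z).hasFDerivAt.const_mul 4).const_sub 2
  have h3 : HasFDerivAt (radialCutoff : E → ℝ) _ z := h1.comp_hasFDerivAt z h2
  rw [h3.fderiv]
  simp [radialWeight]
  ring

variable [FiniteDimensional ℝ E]

lemma hasCompactSupport_radialWeight : HasCompactSupport (radialWeight : E → ℝ) :=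
  HasCompactSupport.intro (isCompact_closedBall 0 1) fun z hz =>
    radialWeight_eq_zero (by simp at hz; exact hz.le)

lemma hasCompactSupport_radialCutoff : HasCompactSupport (radialCutoff : E → ℝ) :=
  HasCompactSupport.intro (isCompact_closedBall 0 1) fun z hz =>
    radialCutoff_eq_zero (by simp at hz; exact hz.le)

lemma integral_radialWeight_pos [Nontrivial E] [MeasurableSpace E] [BorelSpace E]
    {μ : Measure E} [μ.IsAddHaarMeasure] : 0 < ∫ z : E, radialWeight z ∂μ := by
  obtain ⟨c, hc, hc'⟩ := exists_deriv_eq_slope Real.smoothTransition zero_lt_one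
    Real.smoothTransition.continuous.continuousOn
    ((Real.smoothTransition.contDiff (n := 1)).differentiable one_ne_zero).differentiableOn
  obtain ⟨z, hz⟩ := exists_norm_eq E (Real.sqrt_nonneg ((2 - c) / 4))
  have hzc : 2 - 4 * ‖z‖ ^ 2 = c := by
    rw [hz, Real.sq_sqrt (by linarith [hc.2])]
    ring
  refine contDiff_radialWeight.continuous.integral_pos_of_hasCompactSupport_nonneg_nonzero
    (x := z) hasCompactSupport_radialWeight radialWeight_nonneg ?_
  rw [radialWeight, hzc, hc']
  simp

end RadialWeight

section MeanValue

variable {n : ℕ}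

lemma lap_congr {h g : Euc n → ℝ} {x : Euc n} (hg : h =ᶠ[𝓝 x] g) : lap n h x = lap n g x := by
  unfold lap
  refine Finset.sum_congr rfl fun i _ => ?_
  have : (fun y => fderiv ℝ h y (EuclideanSpace.single i 1)) =ᶠ[𝓝 x]
      fun y => fderiv ℝ g y (EuclideanSpace.single i 1) := by
    filter_upwards [Filter.EventuallyEq.fderiv (𝕜 := ℝ) hg] with y hy
    rw [hy]
  rw [this.fderiv_eq]

/-- A `C²` function on a ball agrees on the half ball with a globally `C²` function. -/
lemma exists_contDiff_eqOn_ball {h : Euc n → ℝ} {x : Euc n} {r : ℝ} (hr : 0 < r)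
    (hh : ContDiffOn ℝ 2 h (ball x r)) :
    ∃ g : Euc n → ℝ, ContDiff ℝ 2 g ∧ ∀ y ∈ ball x (r / 2), g y = h y := by
  let χ : ContDiffBump x := ⟨r / 2, 3 * r / 4, by positivity, by linarith⟩
  refine ⟨fun y => χ y * h y, contDiff_iff_contDiffAt.2 fun y => ?_, fun y hy => ?_⟩
  · by_cases hy : y ∈ ball x r
    · exact χ.contDiffAt.mul (hh.contDiffAt (isOpen_ball.mem_nhds hy))
    · have hy' : y ∉ tsupport χ := by
        rw [χ.tsupport_eq]
        simp only [mem_ball, mem_closedBall, not_lt, not_le] at hy ⊢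
        change 3 * r / 4 < _
        linarith
      have h0 : (fun y => χ y * h y) =ᶠ[𝓝 y] fun _ => 0 := by
        filter_upwards [notMem_tsupport_iff_eventuallyEq.1 hy'] with z hz
        simp [hz]
      exact contDiffAt_const.congr_of_eventuallyEq h0
  · have : χ y = 1 := χ.one_of_mem_closedBall (ball_subset_closedBall hy)
    simp [this]

/-- Weighted mean value property of a harmonic function. -/
lemma harmonic_mean_value_of_contDiff {h : Euc n → ℝ} (hh : ContDiff ℝ 2 h) {x : Euc n} {r : ℝ}
    (hr : 0 < r) (hlap : ∀ y ∈ ball x r, lap n h y = 0) :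
    h x * ∫ z : Euc n, radialWeight z = ∫ z : Euc n, h (x + r • z) * radialWeight z := by
  have hh1 : ContDiff ℝ 1 h := hh.of_le (by norm_num)
  have hD : ∀ t : ℝ, HasDerivAt (fun t : ℝ => ∫ z : Euc n, h (x + t • z) * radialWeight z)
      (∫ z : Euc n, fderiv ℝ h (x + t • z) z * radialWeight z) t := fun t =>
    hasDerivAt_integral_line_mul (a := fun _ => x) (b := fun z => z) hh1
      contDiff_radialWeight.continuous hasCompactSupport_radialWeight continuous_const
      continuous_id t
  have hzero : ∀ t ∈ Set.Icc 0 r,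
      ∫ z : Euc n, fderiv ℝ h (x + t • z) z * radialWeight z = 0 := by
    intro t ht
    set e : Fin n → Euc n := fun i => EuclideanSpace.single i 1 with he
    have hp : ∀ i, ContDiff ℝ 1 fun y => fderiv ℝ h y (e i) := fun i =>
      (hh.fderiv_right (m := 1) (by norm_num)).clm_apply contDiff_const
    have hsum : ∀ z : Euc n, fderiv ℝ h (x + t • z) z * radialWeight z
        = ∑ i, -(fderiv ℝ h (x + t • z) (e i) * fderiv ℝ radialCutoff z (e i)) := by
      intro z
      have hz : z = ∑ i, z i • e i := by
        have := (EuclideanSpace.basisFun (Fin n) ℝ).sum_repr z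
        simpa [he] using this.symm
      have h1 : fderiv ℝ h (x + t • z) z = ∑ i, z i * fderiv ℝ h (x + t • z) (e i) := by
        conv_lhs => rw [hz, map_sum]
        refine Finset.sum_congr rfl fun i _ => ?_
        rw [map_smul, smul_eq_mul, ← hz]
      rw [h1, Finset.sum_mul]
      refine Finset.sum_congr rfl fun i _ => ?_
      rw [fderiv_radialCutoff]
      have : ⟪z, e i⟫ = z i := by simp [he, EuclideanSpace.inner_single_right]
      rw [this]
      ring
    have hc0 : Continuous (fderiv ℝ h) := hh1.continuous_fderiv one_ne_zero
    have hc1 : Continuous (fderiv ℝ (radialCutoff : Euc n → ℝ)) :=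
      contDiff_radialCutoff.continuous_fderiv one_ne_zero
    have hc2 : Continuous (radialCutoff : Euc n → ℝ) := contDiff_radialCutoff.continuous
    simp_rw [hsum]
    rw [integral_finsetSum]
    · have : ∀ i, ∫ z : Euc n, -(fderiv ℝ h (x + t • z) (e i) * fderiv ℝ radialCutoff z (e i))
          = t * ∫ z : Euc n, fderiv ℝ (fun y => fderiv ℝ h y (e i)) (x + t • z) (e i)
              * radialCutoff z := by
        intro i
        rw [integral_fderiv_comp_mul (hp i) contDiff_radialCutoff hasCompactSupport_radialCutoff,
          integral_neg]
      simp_rw [this]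
      rw [← Finset.mul_sum, ← integral_finsetSum]
      · have h0 : ∀ z : Euc n, ∑ i, fderiv ℝ (fun y => fderiv ℝ h y (e i)) (x + t • z) (e i)
              * radialCutoff z = 0 := by
          intro z
          rw [← Finset.sum_mul]
          by_cases hz : 1 ≤ ‖z‖
          · rw [radialCutoff_eq_zero hz, mul_zero]
          · have hl := hlap (x + t • z) (by
              rw [mem_ball, dist_self_add_left, norm_smul, Real.norm_of_nonneg ht.1]
              nlinarith [ht.1, ht.2, norm_nonneg z])
            rw [lap] at hl
            rw [hl, zero_mul]
        simp_rw [h0]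
        simp
      · intro i _
        have hc3 : Continuous (fderiv ℝ fun y => fderiv ℝ h y (e i)) :=
          (hp i).continuous_fderiv one_ne_zero
        exact Continuous.integrable_of_hasCompactSupport (by fun_prop)
          hasCompactSupport_radialCutoff.mul_left
    · intro i _
      refine (Continuous.integrable_of_hasCompactSupport (by fun_prop) ?_).neg
      exact (hasCompactSupport_radialCutoff.fderiv_apply (𝕜 := ℝ) (e i)).mul_left
  have hconst := constant_of_has_deriv_right_zero
    (f := fun t : ℝ => ∫ z : Euc n, h (x + t • z) * radialWeight z) (a := 0) (b := r)
    (fun t _ => (hD t).continuousAt.continuousWithinAt)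
    (fun t ht => by
      have := hD t
      rw [hzero t ⟨ht.1, ht.2.le⟩] at this
      exact this.hasDerivWithinAt) r ⟨hr.le, le_rfl⟩
  simp only [zero_smul, add_zero] at hconst
  rw [hconst, integral_const_mul]

lemma harmonic_mean_value {h : Euc n → ℝ} {x : Euc n} {r : ℝ} (hr : 0 < r)
    (hh : ContDiffOn ℝ 2 h (ball x r)) (hlap : ∀ y ∈ ball x r, lap n h y = 0) :
    h x * ∫ z : Euc n, radialWeight z
      = ∫ z : Euc n, h (x + (r / 2) • z) * radialWeight z := by
  obtain ⟨g, hg, hgh⟩ := exists_contDiff_eqOn_ball hr hh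
  have hr2 : 0 < r / 2 := by positivity
  have hsub : ball x (r / 2) ⊆ ball x r := ball_subset_ball (by linarith)
  have := harmonic_mean_value_of_contDiff hg hr2 (x := x) fun y hy => by
    rw [lap_congr (g := h), hlap y (hsub hy)]
    filter_upwards [isOpen_ball.mem_nhds hy] with z hz using hgh z hz
  rw [← hgh x (mem_ball_self hr2), this]
  refine integral_congr_ae (Eventually.of_forall fun z => ?_)
  by_cases hz : 1 ≤ ‖z‖
  · simp [radialWeight_eq_zero hz]
  · have : x + (r / 2) • z ∈ ball x (r / 2) := by
      rw [mem_ball, dist_self_add_left, norm_smul, Real.norm_of_nonneg hr2.le]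
      nlinarith [norm_nonneg z]
    simp only [hgh _ this]

/-- The constant in the interior gradient estimate. -/
def gradConst (n : ℕ) : ℝ :=
  4 * (∫ z : Euc n, ‖fderiv ℝ (radialWeight : Euc n → ℝ) z‖) / ∫ z : Euc n, radialWeight z

lemma gradConst_nonneg (n : ℕ) : 0 ≤ gradConst n :=
  div_nonneg (mul_nonneg (by norm_num) (integral_nonneg fun _ => norm_nonneg _))
    (integral_nonneg fun _ => radialWeight_nonneg _)

/-- Interior gradient estimate for harmonic functions. -/
lemma norm_fderiv_le_of_harmonic [NeZero n] {h : Euc n → ℝ} {x : Euc n} {r B : ℝ} (hr : 0 < r)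
    (hh : ContDiffOn ℝ 2 h (ball x r)) (hlap : ∀ y ∈ ball x r, lap n h y = 0)
    (hB : ∀ y ∈ ball x r, |h y| ≤ B) :
    ‖fderiv ℝ h x‖ ≤ gradConst n * B / r := by
  obtain ⟨g, hg, hgh⟩ := exists_contDiff_eqOn_ball hr hh
  have hr2 : 0 < r / 2 := by positivity
  have hr4 : 0 < r / 4 := by positivity
  have hsub : ball x (r / 2) ⊆ ball x r := ball_subset_ball (by linarith)
  have hg1 : ContDiff ℝ 1 g := hg.of_le (by norm_num)
  have hfd : fderiv ℝ h x = fderiv ℝ g x := Filter.EventuallyEq.fderiv_eq (by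
    filter_upwards [isOpen_ball.mem_nhds (mem_ball_self hr2)] with z hz using (hgh z hz).symm)
  have hlapg : ∀ y ∈ ball x (r / 2), lap n g y = 0 := fun y hy => by
    rw [lap_congr (g := h), hlap y (hsub hy)]
    filter_upwards [isOpen_ball.mem_nhds hy] with z hz using hgh z hz
  have hI : 0 < ∫ z : Euc n, radialWeight z := integral_radialWeight_pos
  have hB0 : 0 ≤ B := (abs_nonneg _).trans (hB x (mem_ball_self hr))
  have hη' : Continuous (fderiv ℝ (radialWeight : Euc n → ℝ)) :=
    contDiff_radialWeight.continuous_fderiv one_ne_zero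
  have hηi : Integrable fun z : Euc n => ‖fderiv ℝ (radialWeight : Euc n → ℝ) z‖ :=
    (hη'.integrable_of_hasCompactSupport (hasCompactSupport_radialWeight.fderiv (𝕜 := ℝ))).norm
  have hrep : ∀ e : Euc n, (r / 4) * (fderiv ℝ g x e * ∫ z : Euc n, radialWeight z)
      = -∫ z : Euc n, g (x + (r / 4) • z) * fderiv ℝ radialWeight z e := by
    intro e
    rw [← integral_fderiv_comp_mul hg1 contDiff_radialWeight hasCompactSupport_radialWeight]
    congr 1
    have hd := hasDerivAt_integral_line_mul (μ := volume) hg1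
      contDiff_radialWeight.continuous hasCompactSupport_radialWeight
      (a := fun z : Euc n => x + (r / 4) • z) (b := fun _ => e) (by fun_prop) (by fun_prop) 0
    have hline : HasDerivAt (fun t : ℝ => x + t • e) e 0 := by
      simpa using ((hasDerivAt_id (0 : ℝ)).smul_const e).const_add x
    have hd2 : HasDerivAt (fun t : ℝ => g (x + t • e)) (fderiv ℝ g x e) 0 := by
      have : HasFDerivAt g (fderiv ℝ g x) (x + (0 : ℝ) • e) := by
        simpa using (hg1.differentiable one_ne_zero x).hasFDerivAt
      exact this.comp_hasDerivAt 0 hline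
    have hd3 := hd2.mul_const (∫ z : Euc n, radialWeight z)
    have heq : (fun t : ℝ => g (x + t • e) * ∫ z : Euc n, radialWeight z) =ᶠ[𝓝 0]
        fun t : ℝ => ∫ z : Euc n, g (x + (r / 4) • z + t • e) * radialWeight z := by
      have hmem : ∀ᶠ t in 𝓝 (0 : ℝ), x + t • e ∈ ball x (r / 4) := by
        refine hline.continuousAt.eventually_mem ?_
        simpa using ball_mem_nhds x hr4
      filter_upwards [hmem] with t ht
      have := harmonic_mean_value_of_contDiff hg hr4 (x := x + t • e) fun y hy => hlapg y (by
        rw [mem_ball] at *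
        linarith [dist_triangle y (x + t • e) x])
      rw [this]
      refine integral_congr_ae (Eventually.of_forall fun z => ?_)
      simp only [add_right_comm]
    have := hd3.unique (heq.hasDerivAt_iff.2 hd)
    simpa using this
  rw [hfd]
  have hC : gradConst n * B / r * (r / 4 * ∫ z : Euc n, radialWeight z)
      = B * ∫ z : Euc n, ‖fderiv ℝ (radialWeight : Euc n → ℝ) z‖ := by
    rw [gradConst]
    field_simp
  have hpos : 0 < r / 4 * ∫ z : Euc n, radialWeight z := by positivity
  refine ContinuousLinearMap.opNorm_le_bound _
    (by have := gradConst_nonneg n; positivity) fun e => ?_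
  rw [← mul_le_mul_iff_of_pos_right hpos]
  have hle : |∫ z : Euc n, g (x + (r / 4) • z) * fderiv ℝ (radialWeight : Euc n → ℝ) z e|
      ≤ ∫ z : Euc n, B * ‖e‖ * ‖fderiv ℝ (radialWeight : Euc n → ℝ) z‖ := by
    rw [← Real.norm_eq_abs]
    refine norm_integral_le_of_norm_le (hηi.const_mul (B * ‖e‖))
      (Eventually.of_forall fun z => ?_)
    by_cases hz : 1 < ‖z‖
    · have hzn : z ∉ tsupport (radialWeight : Euc n → ℝ) := by
        intro hmem
        have : tsupport (radialWeight : Euc n → ℝ) ⊆ closedBall 0 1 :=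
          closure_minimal (fun w hw => by
            by_contra hw'
            exact hw (radialWeight_eq_zero (E := Euc n) (by simp at hw'; exact hw'.le))) isClosed_closedBall
        have := this hmem
        simp at this
        linarith
      have h0 : fderiv ℝ (radialWeight : Euc n → ℝ) z = 0 :=
        image_eq_zero_of_notMem_tsupport
          (fun hm => hzn (tsupport_fderiv_subset ℝ hm))
      simp [h0]
    · have hmem : x + (r / 4) • z ∈ ball x (r / 2) := by
        rw [mem_ball, dist_self_add_left, norm_smul, Real.norm_of_nonneg hr4.le]
        nlinarith [norm_nonneg z]
      rw [norm_mul]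
      have h1 : ‖g (x + (r / 4) • z)‖ ≤ B := by
        rw [hgh _ hmem]
        exact hB _ (hsub hmem)
      calc _ ≤ B * (‖fderiv ℝ (radialWeight : Euc n → ℝ) z‖ * ‖e‖) :=
            mul_le_mul h1 (ContinuousLinearMap.le_opNorm _ _) (norm_nonneg _) hB0
        _ = _ := by ring
  rw [integral_const_mul] at hle
  calc ‖fderiv ℝ g x e‖ * (r / 4 * ∫ z : Euc n, radialWeight z)
      = |(r / 4) * (fderiv ℝ g x e * ∫ z : Euc n, radialWeight z)| := by
        rw [abs_mul, abs_mul, abs_of_pos hI, abs_of_pos hr4, Real.norm_eq_abs]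
        ring
    _ ≤ B * ‖e‖ * ∫ z : Euc n, ‖fderiv ℝ (radialWeight : Euc n → ℝ) z‖ := by
        rw [hrep, abs_neg]
        exact hle
    _ = gradConst n * B / r * ‖e‖ * (r / 4 * ∫ z : Euc n, radialWeight z) := by
        rw [mul_right_comm, ← hC]
        ring

end MeanValue

section PowerLipschitz

lemma abs_inv_pow_sub_inv_pow_le (m : ℕ) {δ a b : ℝ} (hδ : 0 < δ) (ha : δ ≤ a) (hb : δ ≤ b) :
    |(a ^ m)⁻¹ - (b ^ m)⁻¹| ≤ m * (δ ^ (m + 1))⁻¹ * |a - b| := by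
  have key := Convex.norm_image_sub_le_of_norm_hasDerivWithin_le (s := Set.Ici δ)
    (f := fun t : ℝ => (t ^ m)⁻¹) (f' := fun t => -(m * t ^ (m - 1)) / (t ^ m) ^ 2)
    (C := m * (δ ^ (m + 1))⁻¹) (x := b) (y := a) ?_ ?_ (convex_Ici δ) hb ha
  · simpa using key
  · intro t ht
    have ht0 : 0 < t := hδ.trans_le ht
    exact ((hasDerivAt_pow m t).fun_inv (by positivity)).hasDerivWithinAt
  · intro t ht
    have ht0 : 0 < t := hδ.trans_le ht
    have h1 : ‖-(m * t ^ (m - 1)) / (t ^ m) ^ 2‖ = m * (t ^ (m + 1))⁻¹ := by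
      rw [norm_div, norm_neg, Real.norm_of_nonneg (by positivity),
        Real.norm_of_nonneg (by positivity)]
      rcases m with _ | m
      · simp
      · simp only [Nat.add_sub_cancel]
        field_simp
        ring
    rw [h1]
    gcongr
    exact ht

end PowerLipschitz

section NewtonKernel

variable {E : Type*} [NormedAddCommGroup E] [InnerProductSpace ℝ E]

/-- The power kernel `‖z‖^{-m}`. -/
def powKer (m : ℕ) (z : E) : ℝ := (‖z‖ ^ m)⁻¹

/-- The derivative of `powKer m` away from the origin. -/
def powKerDeriv (m : ℕ) (z : E) : E →L[ℝ] ℝ := -((m : ℝ) * (‖z‖ ^ (m + 2))⁻¹) • innerSL ℝ z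

/-- The kernel `‖z‖^{-(m+1)}` restricted to the ball of radius `R`. -/
def singKer (m : ℕ) (R : ℝ) (z : E) : ℝ := if ‖z‖ < R then (‖z‖ ^ (m + 1))⁻¹ else 0

omit [InnerProductSpace ℝ E] in
lemma singKer_nonneg (m : ℕ) (R : ℝ) (z : E) : 0 ≤ singKer m R z := by
  unfold singKer
  split_ifs <;> positivity

omit [InnerProductSpace ℝ E] in
lemma powKer_nonneg (m : ℕ) (z : E) : 0 ≤ powKer m z := by
  unfold powKer
  positivity

omit [InnerProductSpace ℝ E] in
lemma inv_norm_pow_succ_le_singKer (m : ℕ) {R : ℝ} (hR : 0 < R) (z : E) :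
    (‖z‖ ^ (m + 1))⁻¹ ≤ singKer m R z + (R ^ (m + 1))⁻¹ := by
  unfold singKer
  split_ifs with h
  · have : 0 ≤ (R ^ (m + 1))⁻¹ := by positivity
    linarith
  · rw [zero_add]
    gcongr
    exact not_lt.1 h

omit [InnerProductSpace ℝ E] in
lemma powKer_eq_norm_mul {m : ℕ} (hm : 1 ≤ m) (z : E) :
    powKer m z = ‖z‖ * (‖z‖ ^ (m + 1))⁻¹ := by
  unfold powKer
  rcases eq_or_ne z 0 with rfl | hz
  · simp
    omega
  · have : ‖z‖ ≠ 0 := norm_ne_zero_iff.2 hz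
    field_simp
    ring

omit [InnerProductSpace ℝ E] in
lemma powKer_le_singKer {m : ℕ} (hm : 1 ≤ m) {R : ℝ} (hR : 0 < R) (z : E) :
    powKer m z ≤ R * singKer m R z + (R ^ m)⁻¹ := by
  unfold singKer
  split_ifs with h
  · rw [powKer_eq_norm_mul hm]
    have : 0 ≤ (R ^ m)⁻¹ := by positivity
    have : ‖z‖ * (‖z‖ ^ (m + 1))⁻¹ ≤ R * (‖z‖ ^ (m + 1))⁻¹ := by gcongr
    linarith
  · rw [mul_zero, zero_add, powKer]
    gcongr
    exact not_lt.1 h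

lemma norm_powKerDeriv_le (m : ℕ) (z : E) :
    ‖powKerDeriv m z‖ ≤ m * (‖z‖ ^ (m + 1))⁻¹ := by
  rw [powKerDeriv, norm_smul, norm_neg, innerSL_apply_norm, Real.norm_of_nonneg (by positivity)]
  rcases eq_or_ne z 0 with rfl | hz
  · simp
  · have : ‖z‖ ≠ 0 := norm_ne_zero_iff.2 hz
    refine le_of_eq ?_
    field_simp
    ring

lemma hasFDerivAt_powKer (m : ℕ) {z : E} (hz : z ≠ 0) :
    HasFDerivAt (powKer m) (powKerDeriv m z) z := by
  have hz' : 0 < ‖z‖ := norm_pos_iff.2 hz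
  have h1 : HasFDerivAt (fun z : E => ‖z‖) (‖z‖⁻¹ • innerSL ℝ z) z := by
    have h2 := (hasStrictFDerivAt_norm_sq z).hasFDerivAt.sqrt (by positivity)
    refine (h2.congr_of_eventuallyEq (Eventually.of_forall fun w => ?_)).congr_fderiv ?_
    · simp
    · ext w
      simp
      field_simp
  have h3 := ((hasDerivAt_pow m ‖z‖).fun_inv (by positivity)).comp_hasFDerivAt z h1
  refine h3.congr_fderiv ?_
  rw [powKerDeriv, smul_smul]
  congr 1
  rcases m with _ | m
  · simp
  · simp only [Nat.add_sub_cancel]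
    field_simp
    ring

omit [InnerProductSpace ℝ E] in
lemma measurable_powKer [MeasurableSpace E] [BorelSpace E] (m : ℕ) :
    Measurable (powKer m : E → ℝ) := by
  unfold powKer
  exact (measurable_norm.pow_const m).inv

lemma measurable_powKerDeriv [MeasurableSpace E] [BorelSpace E] [FiniteDimensional ℝ E] (m : ℕ) :
    Measurable (powKerDeriv m : E → E →L[ℝ] ℝ) := by
  unfold powKerDeriv
  have h1 : Measurable fun z : E => -((m : ℝ) * (‖z‖ ^ (m + 2))⁻¹) :=
    (measurable_const.mul (measurable_norm.pow_const _).inv).neg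
  exact h1.smul (innerSL ℝ : E →L[ℝ] _).continuous.measurable

omit [InnerProductSpace ℝ E] in
lemma abs_powKer_sub_le (m : ℕ) {δ : ℝ} (hδ : 0 < δ) {a b : E} (ha : δ ≤ ‖a‖) (hb : δ ≤ ‖b‖) :
    |powKer m a - powKer m b| ≤ m * (δ ^ (m + 1))⁻¹ * ‖a - b‖ :=
  (abs_inv_pow_sub_inv_pow_le m hδ ha hb).trans (by
    gcongr
    exact abs_norm_sub_norm_le a b)

lemma norm_powKerDeriv_sub_le (m : ℕ) {δ : ℝ} (hδ : 0 < δ) {a b : E} (ha : δ ≤ ‖a‖)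
    (hb : δ ≤ ‖b‖) (hb' : ‖b‖ ≤ 2 * δ) :
    ‖powKerDeriv m a - powKerDeriv m b‖
      ≤ m * (2 * m + 5) * (δ ^ (m + 2))⁻¹ * ‖a - b‖ := by
  have h1 : powKerDeriv m a - powKerDeriv m b
      = -((m : ℝ)) • innerSL ℝ ((‖a‖ ^ (m + 2))⁻¹ • (a - b)
          + ((‖a‖ ^ (m + 2))⁻¹ - (‖b‖ ^ (m + 2))⁻¹) • b) := by
    ext w
    simp [powKerDeriv]
    ring
  have h2 := abs_inv_pow_sub_inv_pow_le (m + 2) hδ ha hb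
  have h3 : |‖a‖ - ‖b‖| ≤ ‖a - b‖ := abs_norm_sub_norm_le a b
  have h4 : (‖a‖ ^ (m + 2))⁻¹ ≤ (δ ^ (m + 2))⁻¹ := by gcongr
  have h5 : (δ ^ (m + 2 + 1))⁻¹ * (2 * δ) = 2 * (δ ^ (m + 2))⁻¹ := by
    field_simp
    ring
  rw [h1, norm_smul, norm_neg, innerSL_apply_norm, Real.norm_of_nonneg (by positivity),
    mul_assoc, mul_assoc]
  gcongr
  calc _ ≤ ‖(‖a‖ ^ (m + 2))⁻¹ • (a - b)‖
          + ‖((‖a‖ ^ (m + 2))⁻¹ - (‖b‖ ^ (m + 2))⁻¹) • b‖ := norm_add_le _ _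
    _ ≤ (δ ^ (m + 2))⁻¹ * ‖a - b‖
        + (((m + 2 : ℕ) : ℝ) * (δ ^ (m + 2 + 1))⁻¹ * ‖a - b‖) * (2 * δ) := by
        rw [norm_smul, norm_smul, Real.norm_of_nonneg (by positivity), Real.norm_eq_abs]
        gcongr
        refine h2.trans ?_
        gcongr
    _ = (δ ^ (m + 2))⁻¹ * ‖a - b‖
        + ((m + 2 : ℕ) : ℝ) * ‖a - b‖ * ((δ ^ (m + 2 + 1))⁻¹ * (2 * δ)) := by ring
    _ = (2 * m + 5) * ((δ ^ (m + 2))⁻¹ * ‖a - b‖) := by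
        rw [h5]
        push_cast
        ring

end NewtonKernel

section NewtonPotential

variable {E : Type*} [NormedAddCommGroup E] [InnerProductSpace ℝ E] [FiniteDimensional ℝ E]
  [Nontrivial E] [MeasurableSpace E] [BorelSpace E]

/-- The surface constant `d·|B₁|` of a `d`-dimensional space. -/
def ballConst (E : Type*) [NormedAddCommGroup E] [InnerProductSpace ℝ E] [FiniteDimensional ℝ E]
    [MeasurableSpace E] [BorelSpace E] : ℝ :=
  Module.finrank ℝ E * (volume : Measure E).real (ball 0 1)

omit [Nontrivial E] in
lemma ballConst_nonneg : 0 ≤ ballConst E := by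
  unfold ballConst
  positivity

variable {m : ℕ} (hE : Module.finrank ℝ E = m + 2)

include hE

omit [FiniteDimensional ℝ E] [Nontrivial E] [MeasurableSpace E] [BorelSpace E] in
lemma singKer_integrand (R : ℝ) : Set.EqOn
    (fun y : ℝ => y ^ (Module.finrank ℝ E - 1) • (if y < R then (y ^ (m + 1))⁻¹ else 0))
    ((Set.Ioo 0 R).indicator fun _ => (1 : ℝ)) (Set.Ioi 0) := by
  intro y hy
  have hy0 : (y : ℝ) ≠ 0 := ne_of_gt hy
  have hd : Module.finrank ℝ E - 1 = m + 1 := by omega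
  by_cases hyR : y < R
  · rw [Set.indicator_of_mem (show y ∈ Set.Ioo 0 R from ⟨hy, hyR⟩)]
    simp only [hd, hyR, if_true, smul_eq_mul]
    field_simp
  · rw [Set.indicator_of_notMem (fun h : y ∈ Set.Ioo 0 R => hyR h.2)]
    simp [hyR]

lemma integrable_singKer (R : ℝ) : Integrable (singKer m R : E → ℝ) := by
  have := (integrable_fun_norm_addHaar (volume : Measure E)
    (f := fun y : ℝ => if y < R then (y ^ (m + 1))⁻¹ else 0)).2 ?_
  · exact this
  · rw [integrableOn_congr_fun (singKer_integrand hE R) measurableSet_Ioi]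
    exact ((integrable_indicator_iff measurableSet_Ioo).2
      (integrableOn_const (by simp))).integrableOn

lemma integral_singKer {R : ℝ} (hR : 0 ≤ R) : ∫ z : E, singKer m R z = ballConst E * R := by
  have := integral_fun_norm_addHaar (volume : Measure E)
    (f := fun y : ℝ => if y < R then (y ^ (m + 1))⁻¹ else 0)
  rw [setIntegral_congr_fun measurableSet_Ioi (singKer_integrand hE R),
    setIntegral_indicator measurableSet_Ioo, Set.inter_eq_self_of_subset_right
      (fun x hx => hx.1)] at this
  refine (show ∫ z : E, singKer m R z = _ from this).trans ?_
  simp [ballConst, hR, mul_assoc]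

lemma integrable_singKer_sub (R : ℝ) (x : E) : Integrable fun y : E => singKer m R (x - y) :=
  (integrable_singKer hE R).comp_sub_left x

lemma integral_singKer_sub {R : ℝ} (hR : 0 ≤ R) (x : E) :
    ∫ y : E, singKer m R (x - y) = ballConst E * R := by
  rw [integral_sub_left_eq_self, integral_singKer hE hR]

variable {f : E → ℝ} {M : ℝ} (hf : Integrable f) (hM : ∀ y, |f y| ≤ M)

include hf hM

lemma integrable_mul_singKer (R : ℝ) (x : E) :
    Integrable fun y => f y * singKer m R (x - y) :=
  (integrable_singKer_sub hE R x).bdd_mul hf.aestronglyMeasurable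
    (Eventually.of_forall fun y => hM y)

lemma integrable_smul_powKerDeriv (x : E) : Integrable fun y => f y • powKerDeriv m (x - y) := by
  refine Integrable.mono' (((integrable_mul_singKer hE hf.abs (by simpa using hM) 1 x).add
    hf.abs).const_mul (m : ℝ)) ?_ (Eventually.of_forall fun y => ?_)
  · exact hf.aestronglyMeasurable.smul
      ((measurable_powKerDeriv m).comp (measurable_const.sub measurable_id)).aestronglyMeasurable
  · have h1 := norm_powKerDeriv_le m (x - y)
    have h2 := inv_norm_pow_succ_le_singKer m one_pos (x - y)
    rw [norm_smul, Real.norm_eq_abs]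
    calc |f y| * ‖powKerDeriv m (x - y)‖
        ≤ |f y| * (m * (singKer m 1 (x - y) + (1 ^ (m + 1))⁻¹)) := by
          gcongr
          exact h1.trans (by gcongr)
      _ = _ := by simp; ring

lemma integrable_powKer_mul (hm : 1 ≤ m) (x : E) :
    Integrable fun y => powKer m (x - y) * f y := by
  refine Integrable.mono' ((integrable_mul_singKer hE hf.abs (by simpa using hM) 1 x).add
    hf.abs) ?_ (Eventually.of_forall fun y => ?_)
  · exact ((measurable_powKer m).comp
      (measurable_const.sub measurable_id)).aestronglyMeasurable.mul hf.aestronglyMeasurable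
  · have h2 := powKer_le_singKer hm one_pos (x - y)
    rw [norm_mul, Real.norm_eq_abs, Real.norm_eq_abs, abs_of_nonneg (powKer_nonneg _ _)]
    calc powKer m (x - y) * |f y|
        ≤ (1 * singKer m 1 (x - y) + (1 ^ m)⁻¹) * |f y| := by gcongr
      _ = _ := by simp; ring

omit hE hM in
/-- Differentiability of a potential with the kernel truncated at scale `δ`. -/
lemma hasFDerivAt_truncated_potential {δ : ℝ} (hδ : 0 < δ) (x : E) :
    Integrable (fun y => f y • if δ < ‖x - y‖ then powKerDeriv m (x - y) else 0) ∧
    HasFDerivAt (fun x => ∫ y, ((max ‖x - y‖ δ) ^ m)⁻¹ * f y)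
      (∫ y, f y • if δ < ‖x - y‖ then powKerDeriv m (x - y) else 0) x := by
  have hcont : ∀ x : E, Continuous fun y => ((max ‖x - y‖ δ) ^ m)⁻¹ := fun x => by
    refine Continuous.inv₀ (by fun_prop) fun y => ?_
    have : 0 < max ‖x - y‖ δ := lt_max_of_lt_right hδ
    positivity
  refine hasFDerivAt_integral_of_dominated_loc_of_lip
    (F := fun x y => ((max ‖x - y‖ δ) ^ m)⁻¹ * f y)
    (bound := fun y => m * (δ ^ (m + 1))⁻¹ * |f y|) (s := Set.univ) Filter.univ_mem ?_ ?_ ?_ ?_ ?_ ?_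
  · exact Eventually.of_forall fun x =>
      (hcont x).aestronglyMeasurable.mul hf.aestronglyMeasurable
  · refine hf.bdd_mul (c := (δ ^ m)⁻¹) (hcont x).aestronglyMeasurable
      (Eventually.of_forall fun y => ?_)
    have : δ ≤ max ‖x - y‖ δ := le_max_right _ _
    rw [Real.norm_of_nonneg (by positivity)]
    gcongr
  · refine hf.aestronglyMeasurable.smul (Measurable.aestronglyMeasurable ?_)
    have h1 : Measurable fun y : E => x - y := measurable_const.sub measurable_id
    exact Measurable.ite (measurableSet_lt measurable_const h1.norm)
      ((measurable_powKerDeriv m).comp h1) measurable_const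
  · refine Eventually.of_forall fun y => LipschitzOnWith.of_dist_le_mul fun a _ b _ => ?_
    have h1 := abs_inv_pow_sub_inv_pow_le m hδ (le_max_right ‖a - y‖ δ) (le_max_right ‖b - y‖ δ)
    have h2 : |max ‖a - y‖ δ - max ‖b - y‖ δ| ≤ ‖a - b‖ := by
      refine (abs_max_sub_max_le_abs _ _ _).trans ?_
      refine (abs_norm_sub_norm_le _ _).trans ?_
      rw [sub_sub_sub_cancel_right]
    rw [Real.dist_eq, ← sub_mul, abs_mul, dist_eq_norm, Real.coe_nnabs,
      abs_of_nonneg (show 0 ≤ m * (δ ^ (m + 1))⁻¹ * |f y| by positivity)]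
    calc _ ≤ m * (δ ^ (m + 1))⁻¹ * ‖a - b‖ * |f y| := by
          gcongr
          exact h1.trans (by gcongr)
      _ = _ := by ring
  · exact hf.abs.const_mul _
  · have hs : ∀ᵐ y : E, y ∉ sphere x δ :=
      measure_eq_zero_iff_ae_notMem.1 (Measure.addHaar_sphere _ x δ)
    filter_upwards [hs] with y hy
    have hne : ‖x - y‖ ≠ δ := by
      rwa [mem_sphere, dist_comm, dist_eq_norm] at hy
    have hcn : Continuous fun w : E => ‖w - y‖ := by fun_prop
    by_cases hlt : δ < ‖x - y‖
    · rw [if_pos hlt]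
      have h1 : HasFDerivAt (fun w : E => powKer m (w - y)) (powKerDeriv m (x - y)) x := by
        have h2 : HasFDerivAt (powKer m) (powKerDeriv m (x - y)) (x - y) :=
          hasFDerivAt_powKer m (norm_pos_iff.1 (hδ.trans hlt))
        exact h2.comp x ((hasFDerivAt_id x).sub_const y)
      refine (h1.mul_const (f y)).congr_of_eventuallyEq ?_
      filter_upwards [hcn.continuousAt.eventually (lt_mem_nhds hlt)] with w hw
      rw [max_eq_left hw.le, powKer]
    · rw [if_neg hlt, smul_zero]
      have hlt' : ‖x - y‖ < δ := lt_of_le_of_ne (not_lt.1 hlt) hne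
      refine (hasFDerivAt_const ((δ ^ m)⁻¹ * f y) x).congr_of_eventuallyEq ?_
      filter_upwards [hcn.continuousAt.eventually (gt_mem_nhds hlt')] with w hw
      rw [max_eq_right hw.le]

/-- The potential of a bounded integrable density is differentiable, with the expected
derivative. -/
lemma hasFDerivAt_potential (hm : 1 ≤ m) (x : E) :
    HasFDerivAt (fun x => ∫ y, powKer m (x - y) * f y)
      (∫ y, f y • powKerDeriv m (x - y)) x := by
  have hM0 : 0 ≤ M := (abs_nonneg _).trans (hM 0)
  let δ : ℕ → ℝ := fun j => 1 / ((j : ℝ) + 1)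
  have hδ : ∀ j, 0 < δ j := fun j => by positivity
  have hδ0 : Tendsto δ atTop (𝓝 0) := tendsto_one_div_add_atTop_nhds_zero_nat
  have hsrc_int := fun x => integrable_powKer_mul hE hf hM hm x
  have hsrc_int' := fun x => integrable_smul_powKerDeriv hE hf hM x
  refine hasFDerivAt_of_tendstoUniformlyOn (l := atTop) isOpen_univ
    (f := fun j x => ∫ y, ((max ‖x - y‖ (δ j)) ^ m)⁻¹ * f y)
    (f' := fun j x => ∫ y, f y • if δ j < ‖x - y‖ then powKerDeriv m (x - y) else 0)
    (g := fun x => ∫ y, powKer m (x - y) * f y)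
    (g' := fun x => ∫ y, f y • powKerDeriv m (x - y)) ?_
    (fun j x _ => (hasFDerivAt_truncated_potential hf (hδ j) x).2) ?_ (Set.mem_univ x)
  · rw [Metric.tendstoUniformlyOn_iff]
    intro ε hε
    have hlim : Tendsto (fun j => M * m * (ballConst E * δ j)) atTop (𝓝 0) := by
      simpa using (hδ0.const_mul (ballConst E)).const_mul (M * m)
    filter_upwards [hlim.eventually (gt_mem_nhds hε)] with j hj x _
    refine lt_of_le_of_lt ?_ hj
    rw [dist_eq_norm, ← integral_sub (hsrc_int' x) (hasFDerivAt_truncated_potential hf (hδ j) x).1,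
      ← integral_singKer_sub hE (hδ j).le x, ← integral_const_mul]
    have hae : ∀ᵐ y : E, y ∉ sphere x (δ j) :=
      measure_eq_zero_iff_ae_notMem.1 (Measure.addHaar_sphere _ x (δ j))
    refine norm_integral_le_of_norm_le ((integrable_singKer_sub hE (δ j) x).const_mul _) ?_
    filter_upwards [hae] with y hy
    have hne : ‖x - y‖ ≠ δ j := by
      rwa [mem_sphere, dist_comm, dist_eq_norm] at hy
    split_ifs with h
    · rw [sub_self, norm_zero]
      have := singKer_nonneg m (δ j) (x - y)
      positivity
    · have h' : ‖x - y‖ < δ j := lt_of_le_of_ne (not_lt.1 h) hne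
      rw [smul_zero, sub_zero, norm_smul, Real.norm_eq_abs, mul_assoc, singKer, if_pos h']
      exact mul_le_mul (hM y) (norm_powKerDeriv_le _ _) (norm_nonneg _) hM0
  · intro x _
    refine tendsto_integral_of_dominated_convergence (fun y => ‖powKer m (x - y) * f y‖) ?_
      (hsrc_int x).norm ?_ ?_
    · intro j
      refine Continuous.aestronglyMeasurable ?_ |>.mul hf.aestronglyMeasurable
      refine Continuous.inv₀ (by fun_prop) fun y => ?_
      have : 0 < max ‖x - y‖ (δ j) := lt_max_of_lt_right (hδ j)
      positivity
    · intro j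
      have hae : ∀ᵐ y : E, y ≠ x := by
        simp [ae_iff, measure_singleton]
      filter_upwards [hae] with y hy
      have hpos : 0 < ‖x - y‖ := norm_pos_iff.2 (sub_ne_zero.2 hy.symm)
      rw [norm_mul, norm_mul, powKer]
      gcongr
      rw [Real.norm_of_nonneg (by positivity), Real.norm_of_nonneg (by positivity)]
      gcongr
      exact le_max_left _ _
    · have hae : ∀ᵐ y : E, y ≠ x := by
        simp [ae_iff, measure_singleton]
      filter_upwards [hae] with y hy
      have hpos : 0 < ‖x - y‖ := norm_pos_iff.2 (sub_ne_zero.2 hy.symm)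
      refine Tendsto.congr' ?_ tendsto_const_nhds
      filter_upwards [hδ0.eventually (gt_mem_nhds hpos)] with j hj
      rw [max_eq_left hj.le, powKer]

end NewtonPotential

lemma cGreen_nonneg (m : ℕ) : 0 ≤ cGreen (m + 2) := by
  unfold cGreen omegaSph
  push_cast
  have : (0 : ℝ) ≤ (m : ℝ) + 2 - 2 := by
    have : (0 : ℝ) ≤ m := m.cast_nonneg
    linarith
  positivity

lemma norm_rpow_eq_powKer {m : ℕ} (z : Euc (m + 2)) :
    ‖z‖ ^ ((2 : ℝ) - ((m + 2 : ℕ) : ℝ)) = powKer m z := by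
  have : (2 : ℝ) - ((m + 2 : ℕ) : ℝ) = -(m : ℝ) := by push_cast; ring
  rw [this, Real.rpow_neg (norm_nonneg _), Real.rpow_natCast, powKer]

lemma finrank_euc (m : ℕ) : Module.finrank ℝ (Euc (m + 2)) = m + 2 := by simp

lemma lap_sub {n : ℕ} {h g : Euc n → ℝ} {x : Euc n} (hh : ContDiffAt ℝ 2 h x)
    (hg : ContDiffAt ℝ 2 g x) : lap n (fun y => h y - g y) x = lap n h x - lap n g x := by
  unfold lap
  rw [← Finset.sum_sub_distrib]
  refine Finset.sum_congr rfl fun i _ => ?_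
  have hd : ∀ {f : Euc n → ℝ}, ContDiffAt ℝ 2 f x → DifferentiableAt ℝ
      (fun y => fderiv ℝ f y (EuclideanSpace.single i 1)) x := fun hf =>
    ((hf.fderiv_right (m := 1) (by norm_num)).differentiableAt one_ne_zero).clm_apply
      (differentiableAt_const _)
  have he : ∀ {f : Euc n → ℝ}, ContDiffAt ℝ 2 f x → ∀ᶠ y in 𝓝 x, DifferentiableAt ℝ f y :=
    fun hf => (hf.eventually (by simp)).mono fun y hy => hy.differentiableAt (by simp)
  have heq : (fun y => fderiv ℝ (fun y => h y - g y) y (EuclideanSpace.single i 1)) =ᶠ[𝓝 x]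
      fun y => fderiv ℝ h y (EuclideanSpace.single i 1)
        - fderiv ℝ g y (EuclideanSpace.single i 1) := by
    filter_upwards [he hh, he hg] with y h1 h2
    rw [fderiv_fun_sub h1 h2]
    rfl
  rw [heq.fderiv_eq, fderiv_fun_sub (hd hh) (hd hg)]
  rfl

namespace BlowupSetup

variable {m : ℕ} (S : BlowupSetup (m + 2))

lemma H_symm {x y : Euc (m + 2)} (hx : x ∈ S.Ω) (hy : y ∈ S.Ω) : S.H x y = S.H y x := by
  rcases eq_or_ne x y with rfl | hxy
  · rfl
  · have h1 := S.Gdecomp x hx y hy hxy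
    have h2 := S.Gdecomp y hy x hx hxy.symm
    rw [S.Gsymm x y, h2, norm_sub_rev] at h1
    linarith

lemma G_eq {x y : Euc (m + 2)} (hx : x ∈ S.Ω) (hy : y ∈ S.Ω) (hxy : x ≠ y) :
    S.G x y = cGreen (m + 2) * powKer m (x - y) - S.H x y := by
  rw [S.Gdecomp x hx y hy hxy, norm_rpow_eq_powKer]

lemma abs_H_le_powKer {x y : Euc (m + 2)} (hx : x ∈ S.Ω) (hy : y ∈ S.Ω) (hxy : x ≠ y) :
    |S.H x y| ≤ cGreen (m + 2) * powKer m (x - y) := by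
  have h1 := S.G_eq hx hy hxy
  have h2 := S.Gpos x hx y hy hxy
  have h3 := S.Gle x hx y hy hxy
  rw [norm_rpow_eq_powKer] at h3
  rw [abs_le]
  constructor
  · have := mul_nonneg (cGreen_nonneg m) (powKer_nonneg m (x - y))
    linarith
  · linarith

lemma exists_abs_H_le {m : ℕ} (hm : 1 ≤ m) : ∃ C, 0 ≤ C ∧ ∀ (S : BlowupSetup (m + 2))
    (x y : Euc (m + 2)) (r : ℝ), 0 < r → ball x r ⊆ S.Ω → y ∈ S.Ω →
    |S.H x y| ≤ C * (r ^ m)⁻¹ := by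
  obtain ⟨A, hA⟩ := (contDiff_radialWeight (E := Euc (m + 2))).continuous.bounded_above_of_compact_support
    hasCompactSupport_radialWeight
  set I := ∫ z : Euc (m + 2), radialWeight z with hI
  have hIpos : 0 < I := integral_radialWeight_pos
  have hA0 : 0 ≤ A := (norm_nonneg _).trans (hA 0)
  have hc := cGreen_nonneg m
  have hσ := ballConst_nonneg (E := Euc (m + 2))
  refine ⟨cGreen (m + 2) * 2 ^ m * (A * ballConst (Euc (m + 2)) + I) / I, by positivity,
    fun S x y r hr hball hy => ?_⟩
  have hmv := harmonic_mean_value (h := fun z => S.H z y) hr ((S.Hharm y hy).1.mono hball)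
    fun z hz => (S.Hharm y hy).2 z (hball hz)
  set a : Euc (m + 2) := (2 / r) • (y - x) with ha
  have hxa : ∀ z, x + (r / 2) • z - y = (r / 2) • (z - a) := by
    intro z
    rw [ha, smul_sub, smul_smul, div_mul_div_comm, mul_comm r 2, div_self (by positivity), one_smul]
    abel
  have hbound : |∫ z : Euc (m + 2), S.H (x + (r / 2) • z) y * radialWeight z|
      ≤ ∫ z : Euc (m + 2), cGreen (m + 2) * ((r / 2) ^ m)⁻¹
          * (A * singKer m 1 (a - z) + radialWeight z) := by
    rw [← Real.norm_eq_abs]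
    refine norm_integral_le_of_norm_le ?_ ?_
    · exact ((((integrable_singKer_sub (finrank_euc m) 1 a)).const_mul A).add
        (contDiff_radialWeight.continuous.integrable_of_hasCompactSupport
          hasCompactSupport_radialWeight)).const_mul _
    · have hae : ∀ᵐ z : Euc (m + 2), z ≠ a := by simp [ae_iff, measure_singleton]
      filter_upwards [hae] with z hza
      have hw := radialWeight_nonneg z
      have hs := singKer_nonneg m 1 (a - z)
      rw [norm_mul, Real.norm_of_nonneg hw, Real.norm_eq_abs]
      by_cases hz : 1 ≤ ‖z‖
      · rw [radialWeight_eq_zero hz]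
        simp only [mul_zero, add_zero]
        positivity
      · have hmem : x + (r / 2) • z ∈ ball x r := by
          rw [mem_ball, dist_self_add_left, norm_smul, Real.norm_of_nonneg (by positivity)]
          nlinarith [norm_nonneg z]
        have hne : x + (r / 2) • z ≠ y := by
          intro h
          have := hxa z
          rw [h, sub_self, eq_comm, smul_eq_zero, sub_eq_zero] at this
          rcases this with h0 | h0
          · linarith
          · exact hza h0
        have h1 := S.abs_H_le_powKer (hball hmem) hy hne
        have h2 : powKer m ((r / 2) • (z - a)) = ((r / 2) ^ m)⁻¹ * powKer m (a - z) := by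
          rw [powKer, powKer, norm_smul, Real.norm_of_nonneg (by positivity), mul_pow, mul_inv,
            norm_sub_rev]
        have h3 := powKer_le_singKer hm one_pos (a - z)
        rw [hxa, h2] at h1
        have h4 : radialWeight z ≤ A := (le_abs_self _).trans (hA z)
        simp only [one_pow, inv_one, one_mul] at h3
        calc |S.H (x + (r / 2) • z) y| * radialWeight z
            ≤ cGreen (m + 2) * (((r / 2) ^ m)⁻¹ * (singKer m 1 (a - z) + 1))
                * radialWeight z := by
              gcongr
              exact h1.trans (by gcongr)
          _ = cGreen (m + 2) * ((r / 2) ^ m)⁻¹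
                * (radialWeight z * singKer m 1 (a - z) + radialWeight z) := by ring
          _ ≤ _ := by gcongr
  rw [integral_const_mul, integral_add
    ((integrable_singKer_sub (finrank_euc m) 1 a).const_mul A)
    (contDiff_radialWeight.continuous.integrable_of_hasCompactSupport
      hasCompactSupport_radialWeight), integral_const_mul,
    integral_singKer_sub (finrank_euc m) zero_le_one, ← hmv, abs_mul, abs_of_pos hIpos, ← hI,
    mul_one] at hbound
  rw [div_mul_eq_mul_div, le_div_iff₀ hIpos]
  refine hbound.trans (le_of_eq ?_)
  rw [div_pow, inv_div]
  ring

lemma ball_half_subset {n : ℕ} {x y : Euc n} {r : ℝ} {s : Set (Euc n)} (h : ball x r ⊆ s)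
    (hy : y ∈ ball x (r / 2)) : ball y (r / 2) ⊆ s :=
  (ball_subset_ball' (by rw [mem_ball] at hy; linarith)).trans h

lemma exists_norm_fderiv_H_le {m : ℕ} (hm : 1 ≤ m) : ∃ C, 0 ≤ C ∧ ∀ (S : BlowupSetup (m + 2))
    (x y : Euc (m + 2)) (r : ℝ), 0 < r → ball x r ⊆ S.Ω → y ∈ S.Ω →
    ‖fderiv ℝ (fun z => S.H z y) x‖ ≤ C * (r ^ (m + 1))⁻¹ := by
  obtain ⟨C, hC, h⟩ := exists_abs_H_le hm
  have hg := gradConst_nonneg (m + 2)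
  refine ⟨gradConst (m + 2) * (C * 2 ^ (m + 1)), by positivity, fun S x y r hr hball hy => ?_⟩
  have hr2 : 0 < r / 2 := by positivity
  have hsub : ball x (r / 2) ⊆ S.Ω := (ball_subset_ball (by linarith)).trans hball
  refine (norm_fderiv_le_of_harmonic hr2 ((S.Hharm y hy).1.mono hsub)
    (fun z hz => (S.Hharm y hy).2 z (hsub hz))
    (fun z hz => h S z y (r / 2) hr2 (ball_half_subset hball hz) hy)).trans (le_of_eq ?_)
  rw [div_pow, inv_div]
  field_simp
  ring

lemma differentiableAt_H {x y : Euc (m + 2)} (hx : x ∈ S.Ω) (hy : y ∈ S.Ω) :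
    DifferentiableAt ℝ (fun z => S.H z y) x :=
  ((S.Hharm y hy).1.contDiffAt (S.hΩo.mem_nhds hx)).differentiableAt (by simp)

lemma exists_abs_H_sub_le {m : ℕ} (hm : 1 ≤ m) : ∃ C, 0 ≤ C ∧ ∀ (S : BlowupSetup (m + 2))
    (x y₀ y : Euc (m + 2)) (r : ℝ), 0 < r → x ∈ S.Ω → ball y₀ r ⊆ S.Ω → y ∈ ball y₀ (r / 2) →
    |S.H x y - S.H x y₀| ≤ C * (r ^ (m + 1))⁻¹ * ‖y - y₀‖ := by
  obtain ⟨C, hC, h⟩ := exists_norm_fderiv_H_le hm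
  refine ⟨C * 2 ^ (m + 1), by positivity, fun S x y₀ y r hr hx hball hy => ?_⟩
  have hr2 : 0 < r / 2 := by positivity
  have hsub : ball y₀ (r / 2) ⊆ S.Ω := (ball_subset_ball (by linarith)).trans hball
  have hy₀ := mem_ball_self (x := y₀) hr2
  rw [S.H_symm hx (hsub hy), S.H_symm hx (hsub hy₀), ← Real.norm_eq_abs]
  refine (Convex.norm_image_sub_le_of_norm_fderiv_le (f := fun z => S.H z x)
    (fun z hz => S.differentiableAt_H (hsub hz) hx)
    (fun z hz => h S z x (r / 2) hr2 (ball_half_subset hball hz) hx)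
    (convex_ball y₀ (r / 2)) hy₀ hy).trans (le_of_eq ?_)
  rw [div_pow, inv_div]
  ring

lemma exists_norm_fderiv_H_sub_le {m : ℕ} (hm : 1 ≤ m) :
    ∃ C, 0 ≤ C ∧ ∀ (S : BlowupSetup (m + 2))
    (x y₀ y : Euc (m + 2)) (r : ℝ), 0 < r → ball x r ⊆ S.Ω → ball y₀ r ⊆ S.Ω →
    y ∈ ball y₀ (r / 2) →
    ‖fderiv ℝ (fun z => S.H z y) x - fderiv ℝ (fun z => S.H z y₀) x‖
      ≤ C * (r ^ (m + 2))⁻¹ * ‖y - y₀‖ := by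
  obtain ⟨C, hC, h⟩ := exists_abs_H_sub_le hm
  have hg := gradConst_nonneg (m + 2)
  refine ⟨gradConst (m + 2) * C, by positivity, fun S x y₀ y r hr hx hball hy => ?_⟩
  have hyΩ : y ∈ S.Ω := hball (ball_subset_ball (by linarith) hy)
  have hy₀Ω : y₀ ∈ S.Ω := hball (mem_ball_self hr)
  have hxΩ : x ∈ S.Ω := hx (mem_ball_self hr)
  rw [← fderiv_fun_sub (S.differentiableAt_H hxΩ hyΩ) (S.differentiableAt_H hxΩ hy₀Ω)]
  refine (norm_fderiv_le_of_harmonic hr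
    (((S.Hharm y hyΩ).1.sub (S.Hharm y₀ hy₀Ω).1).mono hx) (fun z hz => ?_)
    (fun z hz => h S z y₀ y r hr (hx hz) hball hy)).trans (le_of_eq ?_)
  · have hn := S.hΩo.mem_nhds (hx hz)
    refine (lap_sub ((S.Hharm y hyΩ).1.contDiffAt hn) ((S.Hharm y₀ hy₀Ω).1.contDiffAt hn)).trans ?_
    rw [(S.Hharm y hyΩ).2 z (hx hz), (S.Hharm y₀ hy₀Ω).2 z (hx hz), sub_zero]
  · field_simp
    ring

/-- The derivative in the first variable of the Green-type kernel. -/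
def Gderiv (x y : Euc (m + 2)) : Euc (m + 2) →L[ℝ] ℝ :=
  cGreen (m + 2) • powKerDeriv m (x - y) - fderiv ℝ (fun z => S.H z y) x

lemma hasFDerivAt_G {x y : Euc (m + 2)} (hx : x ∈ S.Ω) (hy : y ∈ S.Ω) (hxy : x ≠ y) :
    HasFDerivAt (fun z => S.G z y) (S.Gderiv x y) x := by
  have h1 : HasFDerivAt (fun z : Euc (m + 2) => powKer m (z - y)) (powKerDeriv m (x - y)) x := by
    have h2 : HasFDerivAt (powKer m) (powKerDeriv m (x - y)) (x - y) :=
      hasFDerivAt_powKer m (sub_ne_zero.2 hxy)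
    exact h2.comp x ((hasFDerivAt_id x).sub_const y)
  refine ((h1.const_mul (cGreen (m + 2))).sub
    (S.differentiableAt_H hx hy).hasFDerivAt).congr_of_eventuallyEq ?_
  filter_upwards [S.hΩo.mem_nhds hx, isOpen_ne.mem_nhds hxy] with z hz hzy
  exact S.G_eq hz hy hzy

end BlowupSetup

lemma integrable_of_integrableOn_of_eq_zero {α F : Type*} [MeasurableSpace α] {μ : Measure α}
    [NormedAddCommGroup F] {f : α → F} {s : Set α} (hf : IntegrableOn f s μ)
    (h0 : ∀ x, x ∉ s → f x = 0) : Integrable f μ :=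
  hf.integrable_of_forall_notMem_eq_zero h0

namespace BlowupSetup

variable {m : ℕ} (S : BlowupSetup (m + 2))

lemma continuousOn_H_right {x : Euc (m + 2)} (hx : x ∈ S.Ω) :
    ContinuousOn (fun y => S.H x y) S.Ω :=
  (S.Hharm x hx).1.continuousOn.congr fun _ hy => S.H_symm hx hy

lemma continuousOn_fderiv_H_right (hm : 1 ≤ m) {x : Euc (m + 2)} (hx : x ∈ S.Ω) :
    ContinuousOn (fun y => fderiv ℝ (fun z => S.H z y) x) S.Ω := by
  intro y₀ hy₀
  obtain ⟨C, hC, h⟩ := exists_norm_fderiv_H_sub_le hm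
  obtain ⟨r₁, hr₁, h₁⟩ := Metric.isOpen_iff.1 S.hΩo x hx
  obtain ⟨r₂, hr₂, h₂⟩ := Metric.isOpen_iff.1 S.hΩo y₀ hy₀
  have hr : 0 < min r₁ r₂ := lt_min hr₁ hr₂
  refine ContinuousAt.continuousWithinAt ?_
  rw [ContinuousAt, tendsto_iff_norm_sub_tendsto_zero]
  have hlim : Tendsto (fun y => C * ((min r₁ r₂) ^ (m + 2))⁻¹ * ‖y - y₀‖) (𝓝 y₀) (𝓝 0) := by
    have : Continuous fun y => C * ((min r₁ r₂) ^ (m + 2))⁻¹ * ‖y - y₀‖ := by fun_prop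
    simpa using this.tendsto y₀
  refine squeeze_zero' (Eventually.of_forall fun _ => norm_nonneg _) ?_ hlim
  filter_upwards [ball_mem_nhds y₀ (half_pos hr)] with y hy
  exact h S x y₀ y _ hr ((ball_subset_ball (min_le_left _ _)).trans h₁)
    ((ball_subset_ball (min_le_right _ _)).trans h₂) hy

lemma volume_Ω_lt_top : volume S.Ω < ⊤ := S.hΩb.measure_lt_top

variable {f : Euc (m + 2) → ℝ} {M : ℝ} (hfc : ContinuousOn f S.Ω)
  (hM : ∀ y, |f y| ≤ M)

include hfc hM

lemma integrableOn_of_continuousOn_bounded : IntegrableOn f S.Ω :=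
  IntegrableOn.of_bound S.volume_Ω_lt_top
    (hfc.aestronglyMeasurable S.hΩo.measurableSet) M (Eventually.of_forall hM)

lemma hasFDerivAt_regular_potential (hm : 1 ≤ m) {x : Euc (m + 2)} (hx : x ∈ S.Ω) :
    IntegrableOn (fun y => f y * S.H x y) S.Ω ∧
    IntegrableOn (fun y => f y • fderiv ℝ (fun z => S.H z y) x) S.Ω ∧
    HasFDerivAt (fun x => ∫ y in S.Ω, f y * S.H x y)
      (∫ y in S.Ω, f y • fderiv ℝ (fun z => S.H z y) x) x := by
  obtain ⟨C₀, hC₀, h₀⟩ := exists_abs_H_le hm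
  obtain ⟨C₁, hC₁, h₁⟩ := exists_norm_fderiv_H_le hm
  obtain ⟨r, hr, hball⟩ := Metric.isOpen_iff.1 S.hΩo x hx
  have hr2 : 0 < r / 2 := by positivity
  have hM0 : 0 ≤ M := (abs_nonneg _).trans (hM 0)
  have hfm := hfc.aestronglyMeasurable (μ := volume) S.hΩo.measurableSet
  have hmeas : ∀ z ∈ S.Ω, AEStronglyMeasurable (fun y => f y * S.H z y)
      (volume.restrict S.Ω) := fun z hz =>
    hfm.mul ((S.continuousOn_H_right hz).aestronglyMeasurable S.hΩo.measurableSet)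
  have hmeas' : AEStronglyMeasurable (fun y => f y • fderiv ℝ (fun z => S.H z y) x)
      (volume.restrict S.Ω) :=
    hfm.smul ((S.continuousOn_fderiv_H_right hm hx).aestronglyMeasurable S.hΩo.measurableSet)
  have hb' : ∀ y ∈ S.Ω, ∀ z ∈ ball x (r / 2), ‖f y • fderiv ℝ (fun z => S.H z y) z‖
      ≤ M * (C₁ * ((r / 2) ^ (m + 1))⁻¹) := by
    intro y hy z hz
    rw [norm_smul, Real.norm_eq_abs]
    exact mul_le_mul (hM y) (h₁ S z y (r / 2) hr2 (ball_half_subset hball hz) hy)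
      (norm_nonneg _) hM0
  have hI : IntegrableOn (fun y => f y * S.H x y) S.Ω := by
    refine IntegrableOn.of_bound S.volume_Ω_lt_top (hmeas x hx) (M * (C₀ * (r ^ m)⁻¹)) ?_
    filter_upwards [ae_restrict_mem S.hΩo.measurableSet] with y hy
    rw [norm_mul]
    exact mul_le_mul (hM y) (h₀ S x y r hr hball hy) (abs_nonneg _) hM0
  refine ⟨hI, ?_, hasFDerivAt_integral_of_dominated_of_fderiv_le
    (F := fun x y => f y * S.H x y)
    (F' := fun x y => f y • fderiv ℝ (fun z => S.H z y) x)
    (bound := fun _ => M * (C₁ * ((r / 2) ^ (m + 1))⁻¹)) (s := ball x (r / 2))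
    (ball_mem_nhds x hr2) ?_ hI hmeas' ?_ ?_ ?_⟩
  · refine IntegrableOn.of_bound S.volume_Ω_lt_top hmeas'
      (M * (C₁ * ((r / 2) ^ (m + 1))⁻¹)) ?_
    filter_upwards [ae_restrict_mem S.hΩo.measurableSet] with y hy
    exact hb' y hy x (mem_ball_self hr2)
  · filter_upwards [S.hΩo.mem_nhds hx] with z hz using hmeas z hz
  · filter_upwards [ae_restrict_mem S.hΩo.measurableSet] with y hy using hb' y hy
  · exact integrableOn_const S.volume_Ω_lt_top.ne
  · filter_upwards [ae_restrict_mem S.hΩo.measurableSet] with y hy z hz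
    exact (S.differentiableAt_H (hball (ball_subset_ball (by linarith) hz)) hy).hasFDerivAt.const_mul
      (f y)

/-- The Green potential of a bounded density supported in `Ω` is differentiable in `Ω`, with the
expected derivative. -/
lemma hasFDerivAt_green_potential (hf0 : ∀ y ∉ S.Ω, f y = 0) (hm : 1 ≤ m) {x : Euc (m + 2)}
    (hx : x ∈ S.Ω) :
    Integrable (fun y => f y * S.G x y) ∧ Integrable (fun y => f y • S.Gderiv x y) ∧
    HasFDerivAt (fun x => ∫ y, f y * S.G x y) (∫ y, f y • S.Gderiv x y) x := by
  have hE := finrank_euc m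
  have hfi : Integrable f := by
    refine (integrableOn_iff_integrable_of_support_subset fun y hy => ?_).1
      (S.integrableOn_of_continuousOn_bounded hfc hM)
    by_contra h
    exact hy (hf0 y h)
  have hae : ∀ z : Euc (m + 2), ∀ᵐ y : Euc (m + 2), y ≠ z := fun z => by
    simp [ae_iff, measure_singleton]
  have hreg := fun z hz => S.hasFDerivAt_regular_potential hfc hM hm (x := z) hz
  have hpot := fun z => (integrable_powKer_mul hE hfi hM hm z).const_mul (cGreen (m + 2))
  have hpotd := (integrable_smul_powKerDeriv hE hfi hM x).smul (cGreen (m + 2))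
  have hind : ∀ z ∈ S.Ω, Integrable (S.Ω.indicator fun y => f y * S.H z y) := fun z hz =>
    (hreg z hz).1.integrable_indicator S.hΩo.measurableSet
  have hindd : Integrable (fun y => f y • fderiv ℝ (fun z => S.H z y) x) := by
    exact integrable_of_integrableOn_of_eq_zero (F := Euc (m + 2) →L[ℝ] ℝ)
      (hreg x hx).2.1 fun y hy => by rw [hf0 y hy, zero_smul]
  have heq : ∀ z ∈ S.Ω, (fun y => f y * S.G z y) =ᵐ[volume] fun y =>
      cGreen (m + 2) * (powKer m (z - y) * f y)
        - S.Ω.indicator (fun y => f y * S.H z y) y := by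
    intro z hz
    filter_upwards [hae z] with y hyz
    by_cases hy : y ∈ S.Ω
    · rw [Set.indicator_of_mem hy, S.G_eq hz hy hyz.symm]
      ring
    · rw [Set.indicator_of_notMem hy, hf0 y hy]
      ring
  have heqd : (fun y => f y • S.Gderiv x y) = fun y =>
      cGreen (m + 2) • (f y • powKerDeriv m (x - y))
        - f y • fderiv ℝ (fun z => S.H z y) x := by
    funext y
    rw [Gderiv, smul_sub, smul_comm]
  have hderiv : HasFDerivAt (fun z => cGreen (m + 2) * (∫ y, powKer m (z - y) * f y)
      - ∫ y in S.Ω, f y * S.H z y)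
      (cGreen (m + 2) • (∫ y, f y • powKerDeriv m (x - y))
        - ∫ y in S.Ω, f y • fderiv ℝ (fun z => S.H z y) x) x :=
    ((hasFDerivAt_potential hE hfi hM hm x).const_mul _).sub (hreg x hx).2.2
  refine ⟨((hpot x).sub (hind x hx)).congr (heq x hx).symm, heqd ▸ hpotd.sub hindd, ?_⟩
  have hval : ∫ y, f y • S.Gderiv x y = cGreen (m + 2) • (∫ y, f y • powKerDeriv m (x - y))
        - ∫ y in S.Ω, f y • fderiv ℝ (fun z => S.H z y) x := by
    rw [heqd]
    refine (integral_sub hpotd hindd).trans ?_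
    rw [setIntegral_eq_integral_of_forall_compl_eq_zero fun y hy => by simp [hf0 y hy]]
    congr 1
    exact integral_smul (cGreen (m + 2)) fun y => f y • powKerDeriv m (x - y)
  rw [hval]
  refine hderiv.congr_of_eventuallyEq ?_
  filter_upwards [S.hΩo.mem_nhds hx] with z hz
  rw [integral_congr_ae (heq z hz)]
  refine (integral_sub (hpot z) (hind z hz)).trans ?_
  rw [integral_indicator S.hΩo.measurableSet, integral_const_mul]

end BlowupSetup

namespace BlowupSetup

variable {m : ℕ}

/-- Size and Lipschitz bounds for the Green kernel and its gradient, with the pole far from the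
centre of the ball in which the second variable moves. -/
lemma exists_green_kernel_bounds (hm : 1 ≤ m) : ∃ C, 0 ≤ C ∧ ∀ (S : BlowupSetup (m + 2))
    (x x₀ : Euc (m + 2)) (d : ℝ), 0 < d → ball x₀ (4 * d) ⊆ S.Ω → ‖x - x₀‖ = 2 * d →
    (∀ y ∈ S.Ω, y ≠ x → ‖d⁻¹ * S.G x y‖ ≤ C * (singKer m d (x - y) + (d ^ (m + 1))⁻¹)) ∧
    (∀ y ∈ S.Ω, ‖S.Gderiv x y‖ ≤ C * (singKer m d (x - y) + (d ^ (m + 1))⁻¹)) ∧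
    (∀ y ∈ ball x₀ d, ‖d⁻¹ * S.G x y - d⁻¹ * S.G x x₀‖ ≤ C * (d ^ (m + 2))⁻¹ * ‖y - x₀‖) ∧
    (∀ y ∈ ball x₀ d, ‖S.Gderiv x y - S.Gderiv x x₀‖ ≤ C * (d ^ (m + 2))⁻¹ * ‖y - x₀‖) := by
  obtain ⟨C₁, hC₁, h₁⟩ := exists_norm_fderiv_H_le hm
  obtain ⟨C₂, hC₂, h₂⟩ := exists_abs_H_sub_le hm
  obtain ⟨C₃, hC₃, h₃⟩ := exists_norm_fderiv_H_sub_le hm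
  have hc := cGreen_nonneg m
  set c := cGreen (m + 2) with hcdef
  have hm0 : (0 : ℝ) ≤ m := m.cast_nonneg
  refine ⟨c + c * m + C₁ + C₂ + c * (m * (2 * m + 5)) + C₃, by positivity,
    fun S x x₀ d hd hball hx => ?_⟩
  have hd2 : 0 < 2 * d := by positivity
  have hx₀ : x₀ ∈ S.Ω := hball (mem_ball_self (by positivity))
  have hbx₀ : ball x₀ (2 * d) ⊆ S.Ω := (ball_subset_ball (by linarith)).trans hball
  have hbx : ball x (2 * d) ⊆ S.Ω := by
    refine (ball_subset_ball' ?_).trans hball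
    rw [dist_eq_norm, hx]
    linarith
  have hxΩ : x ∈ S.Ω := hbx (mem_ball_self hd2)
  have hsing := fun y => singKer_nonneg m d (x - y)
  have hd1 : 0 ≤ (d ^ (m + 1))⁻¹ := by positivity
  have hfar : ∀ y ∈ ball x₀ d, y ∈ S.Ω ∧ y ∈ ball x₀ (2 * d / 2) ∧ d ≤ ‖x - y‖ ∧ x ≠ y ∧
      ‖(x - y) - (x - x₀)‖ = ‖y - x₀‖ := by
    intro y hy
    have hy' : ‖y - x₀‖ < d := by rwa [← dist_eq_norm]
    have h : d ≤ ‖x - y‖ := by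
      have := norm_sub_norm_le (x - x₀) (y - x₀)
      rw [sub_sub_sub_cancel_right] at this
      linarith
    refine ⟨hball (ball_subset_ball (by linarith) hy), ?_, h, ?_, ?_⟩
    · rwa [mul_div_cancel_left₀ d two_ne_zero]
    · rintro rfl
      simp at h
      linarith
    · rw [sub_sub_sub_cancel_left, norm_sub_rev]
  have hb1 : d ≤ ‖x - x₀‖ := by linarith
  have hxx₀ : x ≠ x₀ := by
    rintro rfl
    simp at hx
    linarith
  refine ⟨fun y hy hyx => ?_, fun y hy => ?_, fun y hy => ?_, fun y hy => ?_⟩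
  · have hG0 := S.Gpos x hxΩ y hy hyx.symm
    have hG := S.Gle x hxΩ y hy hyx.symm
    rw [norm_rpow_eq_powKer, ← hcdef] at hG
    have hK := powKer_le_singKer hm hd (x - y)
    rw [Real.norm_eq_abs, abs_of_nonneg (by positivity)]
    calc d⁻¹ * S.G x y ≤ d⁻¹ * (c * (d * singKer m d (x - y) + (d ^ m)⁻¹)) := by
          gcongr
          exact hG.trans (by gcongr)
      _ = c * (singKer m d (x - y) + (d ^ (m + 1))⁻¹) := by
          rw [pow_succ]
          field_simp
      _ ≤ _ := by
          have := hsing y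
          gcongr
          have : 0 ≤ c * m := by positivity
          have : 0 ≤ c * (m * (2 * m + 5)) := by positivity
          linarith
  · have hK := inv_norm_pow_succ_le_singKer m hd (x - y)
    calc ‖S.Gderiv x y‖
        ≤ ‖c • powKerDeriv m (x - y)‖ + ‖fderiv ℝ (fun z => S.H z y) x‖ := norm_sub_le _ _
      _ ≤ c * (m * (singKer m d (x - y) + (d ^ (m + 1))⁻¹)) + C₁ * (d ^ (m + 1))⁻¹ := by
          rw [norm_smul, Real.norm_of_nonneg hc]
          gcongr
          · exact (norm_powKerDeriv_le m _).trans (by gcongr)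
          · exact (h₁ S x y (2 * d) hd2 hbx hy).trans (by gcongr; linarith)
      _ ≤ c * (m * (singKer m d (x - y) + (d ^ (m + 1))⁻¹))
            + C₁ * (singKer m d (x - y) + (d ^ (m + 1))⁻¹) := by
          have := hsing y
          gcongr
          linarith
      _ = (c * m + C₁) * (singKer m d (x - y) + (d ^ (m + 1))⁻¹) := by ring
      _ ≤ _ := by
          have := hsing y
          refine mul_le_mul_of_nonneg_right ?_ (by positivity)
          have : 0 ≤ c * (m * (2 * m + 5)) := by positivity
          linarith
  · obtain ⟨hyΩ, hy2, hfy, hne, hnorm⟩ := hfar y hy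
    rw [S.G_eq hxΩ hyΩ hne, S.G_eq hxΩ hx₀ hxx₀, ← hcdef, ← mul_sub, norm_mul,
      Real.norm_of_nonneg (by positivity : 0 ≤ d⁻¹), Real.norm_eq_abs]
    have hP := abs_powKer_sub_le m hd hfy hb1
    rw [hnorm] at hP
    have hH := h₂ S x x₀ y (2 * d) hd2 hxΩ hbx₀ hy2
    have habs : |c * powKer m (x - y) - S.H x y - (c * powKer m (x - x₀) - S.H x x₀)|
        ≤ c * |powKer m (x - y) - powKer m (x - x₀)| + |S.H x y - S.H x x₀| := by
      have : c * powKer m (x - y) - S.H x y - (c * powKer m (x - x₀) - S.H x x₀)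
          = c * (powKer m (x - y) - powKer m (x - x₀)) - (S.H x y - S.H x x₀) := by ring
      rw [this]
      refine (abs_sub _ _).trans_eq ?_
      rw [abs_mul, abs_of_nonneg hc]
    calc _ ≤ d⁻¹ * (c * (m * (d ^ (m + 1))⁻¹ * ‖y - x₀‖) + C₂ * (d ^ (m + 1))⁻¹ * ‖y - x₀‖) := by
          gcongr
          refine habs.trans ?_
          gcongr
          exact hH.trans (by gcongr; linarith)
      _ = (c * m + C₂) * (d ^ (m + 2))⁻¹ * ‖y - x₀‖ := by
          rw [pow_succ d (m + 1), mul_inv]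
          ring
      _ ≤ _ := by
          rw [mul_assoc, mul_assoc (_ + C₃)]
          refine mul_le_mul_of_nonneg_right ?_ (by positivity)
          have : 0 ≤ c * (m * (2 * m + 5)) := by positivity
          linarith
  · obtain ⟨hyΩ, hy2, hfy, hne, hnorm⟩ := hfar y hy
    have hP := norm_powKerDeriv_sub_le m hd hfy hb1 hx.le
    rw [hnorm] at hP
    have hH := h₃ S x x₀ y (2 * d) hd2 hbx hbx₀ hy2
    have : S.Gderiv x y - S.Gderiv x x₀ = c • (powKerDeriv m (x - y) - powKerDeriv m (x - x₀))
        - (fderiv ℝ (fun z => S.H z y) x - fderiv ℝ (fun z => S.H z x₀) x) := by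
      rw [Gderiv, Gderiv, smul_sub]
      abel
    rw [this]
    refine (norm_sub_le _ _).trans ?_
    rw [norm_smul, Real.norm_of_nonneg hc]
    calc _ ≤ c * (m * (2 * m + 5) * (d ^ (m + 2))⁻¹ * ‖y - x₀‖)
          + C₃ * (d ^ (m + 2))⁻¹ * ‖y - x₀‖ := by
          gcongr
          exact hH.trans (by gcongr; linarith)
      _ = (c * (m * (2 * m + 5)) + C₃) * (d ^ (m + 2))⁻¹ * ‖y - x₀‖ := by ring
      _ ≤ _ := by
          gcongr
          have : 0 ≤ c * m := by positivity
          linarith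

end BlowupSetup

/-- Comparison of a weighted kernel integral with the kernel at the centre of concentration. -/
lemma norm_integral_smul_sub_le {m : ℕ} {F : Type*} [NormedAddCommGroup F] [NormedSpace ℝ F]
    [CompleteSpace F] {Ω : Set (Euc (m + 2))} {f : Euc (m + 2) → ℝ} {K : Euc (m + 2) → F}
    {x x₀ : Euc (m + 2)} {d C M a : ℝ} (hd : 0 < d) (hC : 0 ≤ C) (hM0 : 0 ≤ M)
    (hx : ‖x - x₀‖ = 2 * d) (hx₀ : x₀ ∈ Ω)
    (hf : Integrable f) (hf_nonneg : ∀ y, 0 ≤ f y) (hf0 : ∀ y ∉ Ω, f y = 0)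
    (hfM : ∀ y ∉ ball x₀ d, f y ≤ M) (hfK : Integrable fun y => f y • K y)
    (hK : ∀ y ∈ Ω, y ≠ x → ‖K y‖ ≤ C * (singKer m d (x - y) + (d ^ (m + 1))⁻¹))
    (hKsub : ∀ y ∈ ball x₀ d, ‖K y - K x₀‖ ≤ C * (d ^ (m + 2))⁻¹ * ‖y - x₀‖) :
    ‖(∫ y, f y • K y) - a • K x₀‖ ≤ C * (d ^ (m + 1))⁻¹ *
      ((∫ y in ball x₀ d, (‖y - x₀‖ / d) * f y) + |(∫ y in ball x₀ d, f y) - a|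
        + (∫ y in (ball x₀ d)ᶜ, f y) + ballConst (Euc (m + 2)) * M * d ^ (m + 2)) := by
  have hE := finrank_euc m
  set B := ball x₀ d with hB
  have hBm : MeasurableSet B := measurableSet_ball
  have hxx₀ : x₀ ≠ x := by
    rintro rfl
    simp at hx
    linarith
  have hK₀ : ‖K x₀‖ ≤ C * (d ^ (m + 1))⁻¹ := by
    have h := hK x₀ hx₀ hxx₀
    rwa [singKer, if_neg (by rw [hx]; linarith), zero_add] at h
  have hae : ∀ᵐ y : Euc (m + 2), y ≠ x := by simp [ae_iff, measure_singleton]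
  have hwint : IntegrableOn (fun y => (‖y - x₀‖ / d) * f y) B := by
    refine Integrable.mono' hf.integrableOn (f := fun y => (‖y - x₀‖ / d) * f y) ?_ ?_
    · exact (by fun_prop : Continuous fun y : Euc (m + 2) =>
        ‖y - x₀‖ / d).aestronglyMeasurable.mul hf.aestronglyMeasurable.restrict
    · filter_upwards [ae_restrict_mem hBm] with y hy
      rw [mem_ball, dist_eq_norm] at hy
      have := hf_nonneg y
      rw [Real.norm_of_nonneg (by positivity)]
      refine mul_le_of_le_one_left this ?_
      rw [div_le_one hd]
      exact hy.le
  have hsplit : (∫ y, f y • K y) - a • K x₀ = (∫ y in B, f y • (K y - K x₀))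
      + ((∫ y in B, f y) - a) • K x₀ + ∫ y in Bᶜ, f y • K y := by
    have h1 : ∫ y in B, f y • (K y - K x₀)
        = (∫ y in B, f y • K y) - (∫ y in B, f y) • K x₀ := by
      rw [← integral_smul_const, ← integral_sub hfK.integrableOn
        (hf.integrableOn.smul_const (K x₀))]
      simp only [smul_sub]
    rw [h1, sub_smul, ← integral_add_compl hBm hfK]
    abel
  have hA : ‖∫ y in B, f y • (K y - K x₀)‖
      ≤ C * (d ^ (m + 1))⁻¹ * ∫ y in B, (‖y - x₀‖ / d) * f y := by
    rw [← integral_const_mul]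
    refine norm_integral_le_of_norm_le (hwint.const_mul _) ?_
    filter_upwards [ae_restrict_mem hBm] with y hy
    rw [norm_smul, Real.norm_of_nonneg (hf_nonneg y)]
    calc f y * ‖K y - K x₀‖ ≤ f y * (C * (d ^ (m + 2))⁻¹ * ‖y - x₀‖) :=
          mul_le_mul_of_nonneg_left (hKsub y hy) (hf_nonneg y)
      _ = _ := by
          rw [pow_succ d (m + 1), mul_inv]
          ring
  have hB2 : ‖((∫ y in B, f y) - a) • K x₀‖
      ≤ C * (d ^ (m + 1))⁻¹ * |(∫ y in B, f y) - a| := by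
    rw [norm_smul, Real.norm_eq_abs, mul_comm]
    gcongr
  have hsi := integrable_singKer_sub hE d x
  have hD : ‖∫ y in Bᶜ, f y • K y‖ ≤ C * (d ^ (m + 1))⁻¹ *
      ((∫ y in Bᶜ, f y) + ballConst (Euc (m + 2)) * M * d ^ (m + 2)) := by
    have hbound : ‖∫ y in Bᶜ, f y • K y‖
        ≤ ∫ y in Bᶜ, (C * M * singKer m d (x - y) + C * (d ^ (m + 1))⁻¹ * f y) := by
      refine norm_integral_le_of_norm_le
        ((hsi.integrableOn.const_mul _).add (hf.integrableOn.const_mul _)) ?_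
      filter_upwards [ae_restrict_mem hBm.compl, ae_restrict_of_ae hae] with y hy hyx
      have hs := singKer_nonneg m d (x - y)
      rw [norm_smul, Real.norm_of_nonneg (hf_nonneg y)]
      by_cases hyΩ : y ∈ Ω
      · calc f y * ‖K y‖ ≤ f y * (C * (singKer m d (x - y) + (d ^ (m + 1))⁻¹)) :=
              mul_le_mul_of_nonneg_left (hK y hyΩ hyx) (hf_nonneg y)
          _ = C * f y * singKer m d (x - y) + C * (d ^ (m + 1))⁻¹ * f y := by ring
          _ ≤ _ := by
              gcongr
              exact hfM y hy
      · rw [hf0 y hyΩ, zero_mul]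
        positivity
    refine hbound.trans ?_
    rw [integral_add (hsi.integrableOn.const_mul _) (hf.integrableOn.const_mul _),
      integral_const_mul, integral_const_mul]
    have hle : ∫ y in Bᶜ, singKer m d (x - y) ≤ ballConst (Euc (m + 2)) * d := by
      rw [← integral_singKer_sub hE hd.le x]
      exact setIntegral_le_integral hsi (Eventually.of_forall fun y => singKer_nonneg m d _)
    calc _ ≤ C * M * (ballConst (Euc (m + 2)) * d)
          + C * (d ^ (m + 1))⁻¹ * ∫ y in Bᶜ, f y := by gcongr
      _ = _ := by
          rw [pow_succ d (m + 1)]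
          field_simp
          ring
  rw [hsplit]
  refine (norm_add₃_le).trans ?_
  refine (add_le_add_three hA hB2 hD).trans_eq ?_
  ring

namespace BlowupSetup

variable {m : ℕ} (S : BlowupSetup (m + 2))

lemma Ω_ne_univ : S.Ω ≠ Set.univ := fun h =>
  NormedSpace.unbounded_univ ℝ (Euc (m + 2)) (h ▸ S.hΩb)

lemma frontier_Ω_nonempty (k : ℕ) : (frontier S.Ω).Nonempty :=
  nonempty_frontier_iff.2 ⟨⟨_, S.hxk k⟩, S.Ω_ne_univ⟩

lemma d_pos (k : ℕ) : 0 < S.d k := by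
  have hmem : S.xk k ∉ frontier S.Ω := fun h => by
    rw [S.hΩo.frontier_eq] at h
    exact h.2 (S.hxk k)
  have := (isClosed_frontier.notMem_iff_infDist_pos (S.frontier_Ω_nonempty k)).1 hmem
  exact div_pos this (by norm_num : (0 : ℝ) < 4)

lemma ball_subset_Ω (k : ℕ) : ball (S.xk k) (4 * S.d k) ⊆ S.Ω := by
  have hpos : 0 < 4 * S.d k := mul_pos (by norm_num : (0 : ℝ) < 4) (S.d_pos k)
  have hconn : IsPreconnected (ball (S.xk k) (4 * S.d k)) :=
    (convex_ball _ _).isPreconnected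
  refine hconn.subset_of_closure_inter_subset S.hΩo ⟨_, mem_ball_self hpos, S.hxk k⟩ ?_
  rintro z ⟨hzc, hzb⟩
  by_contra hz
  have hzf : z ∈ frontier S.Ω := by
    rw [S.hΩo.frontier_eq]
    exact ⟨hzc, hz⟩
  have h := infDist_le_dist_of_mem (x := S.xk k) hzf
  rw [mem_ball', d, mul_div_cancel₀ _ (by norm_num : (4 : ℝ) ≠ 0)] at hzb
  exact absurd h (not_le.2 hzb)

lemma lam_pos (k : ℕ) : 0 < S.lam k := by
  rw [S.hlam_eq]
  exact lt_max_of_lt_left (Real.rpow_pos_of_pos (S.hv_pos k _ (S.hxk k)) _)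

lemma N_pos (k : ℕ) : 0 < S.N k := mul_pos (S.lam_pos k) (S.d_pos k)

/-- The source term `v_k ^ p`, extended by zero outside `Ω`. -/
def source (k : ℕ) : Euc (m + 2) → ℝ := S.Ω.indicator fun y => S.v k y ^ S.p

lemma source_nonneg (k : ℕ) (y : Euc (m + 2)) : 0 ≤ S.source k y :=
  Set.indicator_nonneg (fun z hz => Real.rpow_nonneg (S.hv_pos k z hz).le _) y

lemma source_eq_zero (k : ℕ) : ∀ y ∉ S.Ω, S.source k y = 0 := fun _ hy =>
  Set.indicator_of_notMem hy _

lemma continuousOn_source (k : ℕ) : ContinuousOn (S.source k) S.Ω := by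
  refine ContinuousOn.congr ?_ fun y hy => Set.indicator_of_mem hy _
  exact (S.hv_cont k).rpow_const fun x hx => Or.inl (S.hv_pos k x hx).ne'

lemma measurable_source (k : ℕ) : Measurable (S.source k) := by
  classical
  have : S.source k = S.Ω.piecewise (fun y => S.v k y ^ S.p) 0 :=
    (Set.piecewise_eq_indicator).symm
  rw [this]
  refine ContinuousOn.measurable_piecewise ?_ continuousOn_const S.hΩo.measurableSet
  exact (S.hv_cont k).rpow_const fun x hx => Or.inl (S.hv_pos k x hx).ne'

lemma u_eq_integral_source (k : ℕ) {x : Euc (m + 2)} (hx : x ∈ S.Ω) :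
    S.u k x = ∫ y, S.source k y * S.G x y := by
  rw [S.hu_eq k x hx, ← integral_indicator S.hΩo.measurableSet]
  congr 1
  ext y
  by_cases hy : y ∈ S.Ω
  · simp [source, hy, mul_comm]
  · simp [source, hy]

end BlowupSetup

lemma integral_eq_integral_rescaled {m : ℕ} {l : ℝ} (hl : 0 < l) (g : Euc (m + 2) → ℝ)
    (x₀ : Euc (m + 2)) : ∫ y, g y = (l ^ (m + 2))⁻¹ * ∫ z, g (l⁻¹ • z + x₀) := by
  rw [Measure.integral_comp_inv_smul_of_nonneg volume (fun y => g (y + x₀)) hl.le, finrank_euc m,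
    integral_add_right_eq_self (fun y => g y) x₀, smul_eq_mul, ← mul_assoc,
    inv_mul_cancel₀ (by positivity), one_mul]

namespace BlowupSetup

variable {m : ℕ} (S : BlowupSetup (m + 2))

/-- The scaling exponent `n / (p + 1)`. -/
def scal : ℝ := ((m + 2 : ℕ) : ℝ) / (S.p + 1)

lemma p_pos : 0 < S.p := zero_lt_one.trans_le S.hp

lemma scal_add : S.scal + S.scal * S.p = ((m + 2 : ℕ) : ℝ) := by
  have := S.p_pos
  rw [scal]
  field_simp
  ring

/-- The rescaled source term. -/
def profile (k : ℕ) (z : Euc (m + 2)) : ℝ :=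
  S.lam k ^ (-(S.scal * S.p)) * S.source k ((S.lam k)⁻¹ • z + S.xk k)

lemma profile_nonneg (k : ℕ) (z : Euc (m + 2)) : 0 ≤ S.profile k z :=
  mul_nonneg (Real.rpow_nonneg (S.lam_pos k).le _) (S.source_nonneg k _)

lemma measurable_profile (k : ℕ) : Measurable (S.profile k) :=
  ((S.measurable_source k).comp (by fun_prop)).const_mul _

lemma scaled_integral_eq (k : ℕ) (φ : Euc (m + 2) → ℝ) :
    S.lam k ^ S.scal * ∫ y, φ (S.lam k • (y - S.xk k)) * S.source k y
      = ∫ z, φ z * S.profile k z := by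
  have hl := S.lam_pos k
  rw [integral_eq_integral_rescaled hl _ (S.xk k), ← mul_assoc, ← integral_const_mul]
  congr 1
  ext z
  have hexp : S.lam k ^ S.scal * (S.lam k ^ (m + 2))⁻¹ = S.lam k ^ (-(S.scal * S.p)) := by
    rw [← Real.rpow_natCast, ← Real.rpow_neg hl.le, ← Real.rpow_add hl, ← S.scal_add]
    congr 1
    ring
  rw [hexp, add_sub_cancel_right, smul_smul, mul_inv_cancel₀ hl.ne', one_smul, profile]
  ring

variable {C₀ : ℝ} (hC₀ : 0 < C₀)
  (hvbd : ∀ k, ∀ y ∈ S.Ω, S.v k y ≤ C₀ * S.lam k ^ (((m + 2 : ℕ) : ℝ) / (S.p + 1))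
    * (1 + S.lam k * ‖y - S.xk k‖) ^ ((2 : ℝ) - ((m + 2 : ℕ) : ℝ)))

include hC₀ hvbd

lemma source_le (k : ℕ) (y : Euc (m + 2)) : S.source k y ≤
    C₀ ^ S.p * S.lam k ^ (S.scal * S.p) * (1 + S.lam k * ‖y - S.xk k‖) ^ (-(m * S.p)) := by
  have hl := S.lam_pos k
  by_cases hy : y ∈ S.Ω
  · have h1 : 0 ≤ 1 + S.lam k * ‖y - S.xk k‖ := by positivity
    rw [source, Set.indicator_of_mem hy]
    refine (Real.rpow_le_rpow (S.hv_pos k y hy).le (hvbd k y hy) S.p_pos.le).trans_eq ?_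
    rw [Real.mul_rpow (by positivity) (by positivity), Real.mul_rpow hC₀.le (by positivity),
      ← Real.rpow_mul hl.le, ← Real.rpow_mul h1, scal]
    congr 2
    push_cast
    ring
  · rw [S.source_eq_zero k y hy]
    positivity

lemma profile_le (k : ℕ) (z : Euc (m + 2)) :
    S.profile k z ≤ C₀ ^ S.p * (1 + ‖z‖) ^ (-(m * S.p)) := by
  have hl := S.lam_pos k
  have h := S.source_le hC₀ hvbd k ((S.lam k)⁻¹ • z + S.xk k)
  rw [add_sub_cancel_right, norm_smul, norm_inv, Real.norm_of_nonneg hl.le, ← mul_assoc,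
    mul_inv_cancel₀ hl.ne', one_mul] at h
  refine (mul_le_mul_of_nonneg_left h (by positivity)).trans_eq ?_
  rw [Real.rpow_neg hl.le]
  field_simp

variable (hb : ((m + 2 : ℕ) : ℝ) < m * S.p)

include hb

omit hC₀ hvbd in
lemma integrable_profile_bound :
    Integrable fun z : Euc (m + 2) => C₀ ^ S.p * (1 + ‖z‖) ^ (-(m * S.p)) := by
  refine (integrable_one_add_norm ?_).const_mul _
  rwa [finrank_euc m]

omit hC₀ hvbd hb in
lemma tendsto_profile {V : Euc (m + 2) → ℝ} (hVpos : ∀ x, 0 < V x)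
    (hVlim : ∀ x : Euc (m + 2), Tendsto (fun k => S.lam k ^ (-(((m + 2 : ℕ) : ℝ) / (S.p + 1)))
      * S.v k ((S.lam k)⁻¹ • x + S.xk k)) atTop (𝓝 (V x))) (z : Euc (m + 2)) :
    Tendsto (fun k => S.profile k z) atTop (𝓝 (V z ^ S.p)) := by
  refine ((hVlim z).rpow_const (p := S.p) (Or.inl (hVpos z).ne')).congr' ?_
  have hN : Tendsto S.N atTop atTop := S.hN_top
  filter_upwards [hN.eventually_gt_atTop ‖z‖] with k hk
  have hl := S.lam_pos k
  have hmem : (S.lam k)⁻¹ • z + S.xk k ∈ S.Ω := by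
    apply S.ball_subset_Ω k
    rw [mem_ball, dist_eq_norm, add_sub_cancel_right, norm_smul, norm_inv,
      Real.norm_of_nonneg hl.le, inv_mul_lt_iff₀ hl]
    have := S.N_pos k
    have h4 : S.lam k * (4 * S.d k) = 4 * S.N k := by
      rw [N]
      ring
    linarith
  rw [profile, source, Set.indicator_of_mem hmem,
    Real.mul_rpow (by positivity) (S.hv_pos k _ hmem).le, ← Real.rpow_mul hl.le, scal, neg_mul]

lemma tendsto_weighted_integral {V : Euc (m + 2) → ℝ} (hVpos : ∀ x, 0 < V x)
    (hVlim : ∀ x : Euc (m + 2), Tendsto (fun k => S.lam k ^ (-(((m + 2 : ℕ) : ℝ) / (S.p + 1)))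
      * S.v k ((S.lam k)⁻¹ • x + S.xk k)) atTop (𝓝 (V x)))
    {φ : ℕ → Euc (m + 2) → ℝ} (hφm : ∀ k, Measurable (φ k)) (hφ : ∀ k z, |φ k z| ≤ 1) {c : ℝ}
    (hφc : ∀ z, Tendsto (fun k => φ k z) atTop (𝓝 c)) :
    Tendsto (fun k => S.lam k ^ S.scal * ∫ y, φ k (S.lam k • (y - S.xk k)) * S.source k y) atTop
      (𝓝 (c * ∫ z, V z ^ S.p)) := by
  simp_rw [scaled_integral_eq]
  rw [← integral_const_mul]
  refine tendsto_integral_of_dominated_convergence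
    (fun z => C₀ ^ S.p * (1 + ‖z‖) ^ (-(m * S.p)))
    (fun k => ((hφm k).mul (S.measurable_profile k)).aestronglyMeasurable)
    (S.integrable_profile_bound hb) (fun k => Eventually.of_forall fun z => ?_)
    (Eventually.of_forall fun z => (hφc z).mul (S.tendsto_profile hVpos hVlim z))
  rw [norm_mul, Real.norm_eq_abs, Real.norm_of_nonneg (S.profile_nonneg k z)]
  exact (mul_le_of_le_one_left (S.profile_nonneg k z) (hφ k z)).trans
    (S.profile_le hC₀ hvbd k z)

omit hC₀ hvbd in
lemma tendsto_tail : Tendsto (fun k => S.N k ^ (m + 2) * (1 + S.N k) ^ (-(m * S.p))) atTop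
    (𝓝 0) := by
  have hN : Tendsto S.N atTop atTop := S.hN_top
  have hlim : Tendsto (fun k => (1 + S.N k) ^ (-(m * S.p - ((m + 2 : ℕ) : ℝ)))) atTop (𝓝 0) :=
    (tendsto_rpow_neg_atTop (sub_pos.2 hb)).comp (tendsto_atTop_add_const_left _ _ hN)
  refine squeeze_zero (fun k => ?_) (fun k => ?_) hlim
  · have := S.N_pos k
    positivity
  · have := S.N_pos k
    have h1 : 0 < 1 + S.N k := by positivity
    calc _ ≤ (1 + S.N k) ^ (m + 2) * (1 + S.N k) ^ (-(m * S.p)) := by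
          gcongr
          linarith
      _ = _ := by
          rw [← Real.rpow_natCast, ← Real.rpow_add h1]
          congr 1
          ring

/-- The rescaled error measuring the concentration of the source term at `x_k` tends to zero. -/
lemma exists_tendsto_error {V : Euc (m + 2) → ℝ} (hVpos : ∀ x, 0 < V x)
    (hVlim : ∀ x : Euc (m + 2), Tendsto (fun k => S.lam k ^ (-(((m + 2 : ℕ) : ℝ) / (S.p + 1)))
      * S.v k ((S.lam k)⁻¹ • x + S.xk k)) atTop (𝓝 (V x))) (K : ℝ) (hK : 0 ≤ K) :
    ∃ E : ℕ → ℝ, (∀ k, 0 ≤ E k) ∧ Tendsto E atTop (𝓝 0) ∧ ∀ k,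
      (∫ y in ball (S.xk k) (S.d k), (‖y - S.xk k‖ / S.d k) * S.source k y)
        + |(∫ y in ball (S.xk k) (S.d k), S.source k y)
            - (∫ z, V z ^ S.p) * S.lam k ^ (-S.scal)|
        + (∫ y in (ball (S.xk k) (S.d k))ᶜ, S.source k y)
        + K * (C₀ ^ S.p * S.lam k ^ (S.scal * S.p) * (1 + S.N k) ^ (-(m * S.p)))
            * S.d k ^ (m + 2) = E k * S.lam k ^ (-S.scal) := by
  have hN : Tendsto S.N atTop atTop := S.hN_top
  set AV := ∫ z, V z ^ S.p
  set φ₁ : ℕ → Euc (m + 2) → ℝ := fun k => (ball 0 (S.N k)).indicator fun z => ‖z‖ / S.N k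
  set φ₂ : ℕ → Euc (m + 2) → ℝ := fun k => (ball 0 (S.N k)).indicator fun _ => 1
  set φ₃ : ℕ → Euc (m + 2) → ℝ := fun k => (ball 0 (S.N k))ᶜ.indicator fun _ => 1
  have hmem : ∀ k y, S.lam k • (y - S.xk k) ∈ ball (0 : Euc (m + 2)) (S.N k)
      ↔ y ∈ ball (S.xk k) (S.d k) := fun k y => by
    rw [mem_ball_zero_iff, mem_ball, dist_eq_norm, norm_smul, Real.norm_of_nonneg (S.lam_pos k).le,
      N, mul_lt_mul_iff_right₀ (S.lam_pos k)]
  have hev : ∀ z : Euc (m + 2), ∀ᶠ k in atTop, z ∈ ball (0 : Euc (m + 2)) (S.N k) := fun z => by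
    filter_upwards [hN.eventually_gt_atTop ‖z‖] with k hk
    rwa [mem_ball_zero_iff]
  have hlim := fun (φ : ℕ → Euc (m + 2) → ℝ) hm h1 c hc =>
    S.tendsto_weighted_integral hC₀ hvbd hb hVpos hVlim (φ := φ) hm h1 (c := c) hc
  have hT₁ := hlim φ₁
    (fun k => (by fun_prop : Measurable fun z : Euc (m + 2) => ‖z‖ / S.N k).indicator
      measurableSet_ball)
    (fun k z => by
      have := S.N_pos k
      by_cases hz : z ∈ ball (0 : Euc (m + 2)) (S.N k)
      · simp only [φ₁, Set.indicator_of_mem hz]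
        rw [mem_ball_zero_iff] at hz
        rw [abs_of_nonneg (by positivity), div_le_one this]
        exact hz.le
      · simp [φ₁, Set.indicator_of_notMem hz]) 0
    (fun z => by
      refine (hN.const_div_atTop ‖z‖).congr' ?_
      filter_upwards [hev z] with k hk
      simp only [φ₁, Set.indicator_of_mem hk])
  have hT₂ := hlim φ₂ (fun k => measurable_const.indicator measurableSet_ball)
    (fun k z => by
      by_cases hz : z ∈ ball (0 : Euc (m + 2)) (S.N k)
      · simp only [φ₂, Set.indicator_of_mem hz, abs_one, le_refl]
      · simp [φ₂, Set.indicator_of_notMem hz]) 1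
    (fun z => by
      refine tendsto_const_nhds.congr' ?_
      filter_upwards [hev z] with k hk
      simp only [φ₂, Set.indicator_of_mem hk])
  have hT₃ := hlim φ₃ (fun k => measurable_const.indicator measurableSet_ball.compl)
    (fun k z => by
      by_cases hz : z ∈ (ball (0 : Euc (m + 2)) (S.N k))ᶜ
      · simp only [φ₃, Set.indicator_of_mem hz, abs_one, le_refl]
      · simp only [φ₃, Set.indicator_of_notMem hz, abs_zero, zero_le_one]) 0
    (fun z => by
      refine tendsto_const_nhds.congr' ?_
      filter_upwards [hev z] with k hk
      have : z ∉ (ball (0 : Euc (m + 2)) (S.N k))ᶜ := fun h => h hk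
      simp only [φ₃, Set.indicator_of_notMem this])
  have e₁ : ∀ k, ∫ y, φ₁ k (S.lam k • (y - S.xk k)) * S.source k y
      = ∫ y in ball (S.xk k) (S.d k), (‖y - S.xk k‖ / S.d k) * S.source k y := fun k => by
    rw [← integral_indicator measurableSet_ball]
    congr 1
    ext y
    have hl := S.lam_pos k
    by_cases hy : y ∈ ball (S.xk k) (S.d k)
    · simp only [φ₁, Set.indicator_of_mem hy, Set.indicator_of_mem ((hmem k y).2 hy)]
      rw [norm_smul, Real.norm_of_nonneg hl.le, N, mul_div_mul_left _ _ hl.ne']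
    · simp only [φ₁, Set.indicator_of_notMem hy, Set.indicator_of_notMem (mt (hmem k y).1 hy),
        zero_mul]
  have e₂ : ∀ k, ∫ y, φ₂ k (S.lam k • (y - S.xk k)) * S.source k y
      = ∫ y in ball (S.xk k) (S.d k), S.source k y := fun k => by
    rw [← integral_indicator measurableSet_ball]
    congr 1
    ext y
    by_cases hy : y ∈ ball (S.xk k) (S.d k)
    · simp only [φ₂, Set.indicator_of_mem hy, Set.indicator_of_mem ((hmem k y).2 hy), one_mul]
    · simp only [φ₂, Set.indicator_of_notMem hy, Set.indicator_of_notMem (mt (hmem k y).1 hy),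
        zero_mul]
  have e₃ : ∀ k, ∫ y, φ₃ k (S.lam k • (y - S.xk k)) * S.source k y
      = ∫ y in (ball (S.xk k) (S.d k))ᶜ, S.source k y := fun k => by
    rw [← integral_indicator measurableSet_ball.compl]
    congr 1
    ext y
    by_cases hy : y ∈ (ball (S.xk k) (S.d k))ᶜ
    · have : S.lam k • (y - S.xk k) ∈ (ball (0 : Euc (m + 2)) (S.N k))ᶜ := mt (hmem k y).1 hy
      simp only [φ₃, Set.indicator_of_mem hy, Set.indicator_of_mem this, one_mul]
    · have : S.lam k • (y - S.xk k) ∉ (ball (0 : Euc (m + 2)) (S.N k))ᶜ := fun h =>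
        hy (mt (hmem k y).2 h)
      simp only [φ₃, Set.indicator_of_notMem hy, Set.indicator_of_notMem this, zero_mul]
  simp only [e₁, e₂, e₃, zero_mul, one_mul] at hT₁ hT₂ hT₃
  have hT₄ := (S.tendsto_tail hb).const_mul (K * C₀ ^ S.p)
  rw [mul_zero] at hT₄
  have hT₂' := (hT₂.sub_const AV).abs
  rw [sub_self, abs_zero] at hT₂'
  refine ⟨_, fun k => ?_, by simpa using ((hT₁.add hT₂').add hT₃).add hT₄, fun k => ?_⟩
  · have hl := S.lam_pos k
    have hn := S.N_pos k
    have hd := S.d_pos k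
    have hs := S.source_nonneg k
    have i₁ : 0 ≤ ∫ y in ball (S.xk k) (S.d k), (‖y - S.xk k‖ / S.d k) * S.source k y :=
      integral_nonneg fun y => mul_nonneg (by positivity) (hs y)
    have i₃ : 0 ≤ ∫ y in (ball (S.xk k) (S.d k))ᶜ, S.source k y := integral_nonneg fun y => hs y
    positivity
  · have hl := S.lam_pos k
    have hls : 0 < S.lam k ^ S.scal := by positivity
    have hsp : S.lam k ^ (S.scal * S.p) = S.lam k ^ (m + 2) * (S.lam k ^ S.scal)⁻¹ := by
      rw [← Real.rpow_natCast, ← Real.rpow_neg hl.le, ← Real.rpow_add hl, ← S.scal_add]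
      congr 1
      ring
    have habs : |S.lam k ^ S.scal * (∫ y in ball (S.xk k) (S.d k), S.source k y) - AV|
        = S.lam k ^ S.scal * |(∫ y in ball (S.xk k) (S.d k), S.source k y)
            - AV * S.lam k ^ (-S.scal)| := by
      rw [← abs_of_pos hls, ← abs_mul, abs_of_pos hls, mul_sub, Real.rpow_neg hl.le]
      congr 2
      field_simp
    rw [habs, hsp, N, mul_pow, Real.rpow_neg hl.le S.scal]
    field_simp

end BlowupSetup

namespace BlowupSetup

variable {m : ℕ} (S : BlowupSetup (m + 2))

lemma hasFDerivAt_u (hm : 1 ≤ m) {M : ℝ} (k : ℕ) (hM : ∀ y, |S.source k y| ≤ M)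
    {x : Euc (m + 2)} (hx : x ∈ S.Ω) :
    HasFDerivAt (S.u k) (∫ y, S.source k y • S.Gderiv x y) x := by
  refine (S.hasFDerivAt_green_potential (S.continuousOn_source k) hM (S.source_eq_zero k)
    hm hx).2.2.congr_of_eventuallyEq ?_
  filter_upwards [S.hΩo.mem_nhds hx] with z hz
  exact S.u_eq_integral_source k hz

end BlowupSetup

/-- Sharp estimate of `u_k` and its gradient on the annulus `|x - x_k| = 2 d_k`
in terms of the Green function, for `n/(n-2) < p ≤ (n+2)/(n-2)`. -/
theorem u_estimate_on_annulus
    (n : ℕ) (hn : 3 ≤ n) (S : BlowupSetup n)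
    (hp_low : (n : ℝ) / ((n : ℝ) - 2) < S.p)
    (hp_high : S.p ≤ ((n : ℝ) + 2) / ((n : ℝ) - 2))
    (hd0 : Filter.Tendsto S.d Filter.atTop (nhds 0))
    (C₀ : ℝ) (hC₀ : 0 < C₀)
    (hvbd : ∀ k, ∀ y ∈ S.Ω,
      S.v k y ≤ C₀ * S.lam k ^ ((n : ℝ) / (S.p + 1))
        * (1 + S.lam k * ‖y - S.xk k‖) ^ ((2 : ℝ) - n))
    (V : Euc n → ℝ) (hVc : Continuous V) (hVpos : ∀ x, 0 < V x)
    (hVbd : ∀ x, V x ≤ C₀ * (1 + ‖x‖) ^ ((2 : ℝ) - n))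
    (hVlim : ∀ x : Euc n,
      Filter.Tendsto
        (fun k => S.lam k ^ (-((n : ℝ) / (S.p + 1))) * S.v k ((S.lam k)⁻¹ • x + S.xk k))
        Filter.atTop (nhds (V x)))
    (AV : ℝ) (hAV : AV = ∫ y, (V y) ^ S.p) :
    (∀ k, DifferentiableOn ℝ (S.u k) S.Ω) ∧
    ∃ η : ℕ → ℝ, (∀ k, 0 ≤ η k) ∧ Filter.Tendsto η Filter.atTop (nhds 0) ∧
      ∀ k, ∀ x : Euc n, ‖x - S.xk k‖ = 2 * S.d k →
        |S.u k x - AV * S.lam k ^ (-((n : ℝ) / (S.p + 1))) * S.G x (S.xk k)|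
            ≤ η k * S.lam k ^ (-((n : ℝ) / (S.p + 1))) * S.d k ^ (-((n : ℝ) - 2)) ∧
        ‖gradient (S.u k) x
            - (AV * S.lam k ^ (-((n : ℝ) / (S.p + 1)))) •
                gradient (fun z => S.G z (S.xk k)) x‖
            ≤ η k * S.lam k ^ (-((n : ℝ) / (S.p + 1))) * S.d k ^ (-((n : ℝ) - 1)) := by
  obtain ⟨m, rfl⟩ : ∃ m, n = m + 2 := ⟨n - 2, by omega⟩
  have hm : 1 ≤ m := by omega
  have hm0 : (0 : ℝ) < m := by exact_mod_cast hm
  have hcast : ((m + 2 : ℕ) : ℝ) - 2 = m := by push_cast; ring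
  have hb : ((m + 2 : ℕ) : ℝ) < m * S.p := by
    rw [hcast, div_lt_iff₀ hm0] at hp_low
    linarith
  have hsrc := S.source_le hC₀ hvbd
  have hexp : -(m * S.p) ≤ 0 := by
    have := S.p_pos
    have : 0 ≤ m * S.p := by positivity
    linarith
  have hM : ∀ k y, |S.source k y| ≤ C₀ ^ S.p * S.lam k ^ (S.scal * S.p) := fun k y => by
    have hl := S.lam_pos k
    rw [abs_of_nonneg (S.source_nonneg k y)]
    refine (hsrc k y).trans (mul_le_of_le_one_right (by positivity) ?_)
    refine Real.rpow_le_one_of_one_le_of_nonpos ?_ hexp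
    have : 0 ≤ S.lam k * ‖y - S.xk k‖ := by positivity
    linarith
  have hder := fun k x (hx : x ∈ S.Ω) => S.hasFDerivAt_u hm k (hM k) hx
  refine ⟨fun k x hx => (hder k x hx).differentiableAt.differentiableWithinAt, ?_⟩
  obtain ⟨C, hC, hker⟩ := BlowupSetup.exists_green_kernel_bounds hm
  obtain ⟨E, hE0, hElim, hE⟩ := S.exists_tendsto_error hC₀ hvbd hb hVpos hVlim
    (ballConst (Euc (m + 2))) ballConst_nonneg
  rw [← hAV] at hE
  refine ⟨fun k => C * E k, fun k => mul_nonneg hC (hE0 k), by simpa using hElim.const_mul C,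
    fun k x hx => ?_⟩
  have hl := S.lam_pos k
  have hd := S.d_pos k
  have hN := S.N_pos k
  have hball := S.ball_subset_Ω k
  have hxΩ : x ∈ S.Ω := hball (by rw [mem_ball, dist_eq_norm, hx]; linarith)
  have hxne : x ≠ S.xk k := by
    rintro rfl
    simp at hx
    linarith
  obtain ⟨hK₁, hK₂, hK₃, hK₄⟩ := hker S x (S.xk k) (S.d k) hd hball hx
  obtain ⟨hi₁, hi₂, -⟩ := S.hasFDerivAt_green_potential (S.continuousOn_source k) (hM k)
    (S.source_eq_zero k) hm hxΩ
  have hsrc_int : Integrable (S.source k) := integrable_of_integrableOn_of_eq_zero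
    (S.integrableOn_of_continuousOn_bounded (S.continuousOn_source k) (hM k))
    (S.source_eq_zero k)
  have hfar : ∀ y ∉ ball (S.xk k) (S.d k), S.source k y ≤
      C₀ ^ S.p * S.lam k ^ (S.scal * S.p) * (1 + S.N k) ^ (-(m * S.p)) := fun y hy => by
    refine (hsrc k y).trans (mul_le_mul_of_nonneg_left ?_ (by positivity))
    rw [mem_ball, dist_eq_norm, not_lt] at hy
    refine Real.rpow_le_rpow_of_nonpos (by positivity) ?_ hexp
    rw [BlowupSetup.N]
    gcongr
  have hscal : (((m + 2 : ℕ) : ℝ) / (S.p + 1)) = S.scal := rfl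
  have hd1 : S.d k ^ (-(((m + 2 : ℕ) : ℝ) - 1)) = (S.d k ^ (m + 1))⁻¹ := by
    rw [Real.rpow_neg hd.le, ← Real.rpow_natCast]
    congr 2
    push_cast
    ring
  have hd2 : S.d k ^ (-(((m + 2 : ℕ) : ℝ) - 2)) = (S.d k ^ m)⁻¹ := by
    rw [Real.rpow_neg hd.le, hcast, Real.rpow_natCast]
  have hM0 : 0 ≤ C₀ ^ S.p * S.lam k ^ (S.scal * S.p) * (1 + S.N k) ^ (-(m * S.p)) := by
    positivity
  have hi₁' : Integrable fun y => S.source k y • ((S.d k)⁻¹ * S.G x y) := by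
    simpa only [smul_eq_mul, mul_left_comm] using hi₁.const_mul (S.d k)⁻¹
  have hval := norm_integral_smul_sub_le (a := AV * S.lam k ^ (-S.scal)) hd hC hM0 hx (S.hxk k)
    hsrc_int (S.source_nonneg k) (S.source_eq_zero k) hfar hi₁' hK₁ hK₃
  have hgrad := norm_integral_smul_sub_le (a := AV * S.lam k ^ (-S.scal)) hd hC hM0 hx (S.hxk k)
    hsrc_int (S.source_nonneg k) (S.source_eq_zero k) hfar hi₂ (fun y hy _ => hK₂ y hy) hK₄
  rw [hE k] at hval hgrad
  rw [hscal, hd1, hd2]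
  constructor
  · have hu : (∫ y, S.source k y • ((S.d k)⁻¹ * S.G x y)) = (S.d k)⁻¹ * S.u k x := by
      rw [S.u_eq_integral_source k hxΩ, ← integral_const_mul]
      congr 1
      ext y
      rw [smul_eq_mul]
      ring
    have hfac : (S.d k)⁻¹ * S.u k x
        - (AV * S.lam k ^ (-S.scal)) • ((S.d k)⁻¹ * S.G x (S.xk k))
        = (S.d k)⁻¹ * (S.u k x - AV * S.lam k ^ (-S.scal) * S.G x (S.xk k)) := by
      rw [smul_eq_mul]
      ring
    rw [hu, hfac, norm_mul, norm_inv, Real.norm_of_nonneg hd.le, Real.norm_eq_abs,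
      inv_mul_le_iff₀ hd] at hval
    refine hval.trans_eq ?_
    rw [pow_succ]
    field_simp
  · have hG := (S.hasFDerivAt_G hxΩ (S.hxk k) hxne).fderiv
    rw [gradient, gradient, (hder k x hxΩ).fderiv, hG, ← map_smul, ← map_sub,
      LinearIsometryEquiv.norm_map]
    refine hgrad.trans_eq ?_
    ring
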